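/- Let $(M,g)$ be a smooth Riemannian manifold (without boundary) of dimension $n\ge 3$, with Levi-Civita connection $\nabla$, Riemann curvature tensor $R(X,Y)Z=\nabla_X\nabla_YZ-\nabla_Y\nabla_XZ-\nabla_{[X,Y]}Z$, and $(\nabla_WR)$ the covariant derivative of $R$. In the coordinates $(x^i,y^i)$ of $TM$ induced by coordinates $(x^i)$ of $M$, the vertical and horizontal lifts of a vector field $X=X^i\partial/\partial x^i$ are $X^v=X^i\,\partial/\partial y^i$ and $X^h=X^i\bigl(\partial/\partial x^i-y^a\Gamma^j_{ai}\,\partial/\partial y^j\bigr)$, where $\Gamma^j_{ai}$ are the Christoffel symbols of $g$; tangent vectors are lifted in the same way. Let $a,b,c\in\mathbb R$ with $a>0$ and $\alpha:=a(a+c)-b^2>0$, and let $G=a\,g^s+b\,g^h+c\,g^v$ be the $g$-natural metric on $TM$, that is, the Riemannian metric with $$G(X^h,Y^h)=(a+c)\,g(X,Y),\qquad G(X^h,Y^v)=G(X^v,Y^h)=b\,g(X,Y),\qquad G(X^v,Y^v)=a\,g(X,Y).$$ Let $\widetilde R$ be the Riemann curvature tensor of $(TM,G)$ (with the same sign convention).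 Then for all smooth vector fields $X,Y,Z$ on $M$ (or on an open subset of $M$) and at every point $(x,y)\in TM$ (with $x$ in that subset), writing $t$ for the vector $y\in T_xM$, $$\begin{aligned} \widetilde R(X^h,Y^h)Z^h={}&\Bigl\{R(X,Y)Z+\tfrac{ab}{2\alpha}\bigl[2(\nabla_tR)(X,Y)Z-(\nabla_ZR)(X,Y)t\bigr]\\ &+\tfrac{a^2}{4\alpha}\bigl[R(R(Y,Z)t,t)X-R(R(X,Z)t,t)Y\bigr]\\ &+\tfrac{a^2b^2}{4\alpha^2}\bigl[R(X,t)R(Y,t)Z+R(X,t)R(Z,t)Y-R(Y,t)R(X,t)Z-R(Y,t)R(Z,t)X\bigr]\\ &-\tfrac{a^2}{2\alpha}R(R(X,Y)t,t)Z\Bigr\}^h\\ &+\Bigl\{-\tfrac{b^2}{\alpha}(\nabla_tR)(X,Y)Z+\tfrac{a(a+c)}{2\alpha}(\nabla_ZR)(X,Y)t\\ &+\tfrac{ab^3}{2\alpha^2}\bigl[R(R(Y,t)Z,X)t-R(X,t)R(Z,t)Y-R(R(X,t)Z,Y)t+R(Y,t)R(Z,t)X\bigr]\\ &+\tfrac{a^2b(a+c)}{4\alpha^2}\bigl[R(X,R(Y,t)Z)t+R(X,R(Z,t)Y)t-R(Y,R(X,t)Z)t-R(Y,R(Z,t)X)t\\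 &\qquad-R(R(Y,Z)t,t)X+R(R(X,Z)t,t)Y\bigr]+\tfrac{ab}{2\alpha}R(R(X,Y)t,t)Z\Bigr\}^v, \end{aligned}$$ where the left side is evaluated at $(x,y)$, the tensors on the right are evaluated at $x$, and the lifts on the right are taken at $(x,y)$. (Since the right side is tensorial in $t$, one may equivalently let $t$ be any smooth vector field near $x$ with $t(x)=y$.) -/

import Mathlib

set_option maxSynthPendingDepth 3

open Bundle VectorField
open scoped Manifold ContDiff

noncomputable section

namespace GNat

/-- The bilinear form `(v, w) ↦ B (e v) (e' w)`. -/
def pullBilin {V V' W : Type*} [AddCommGroup V] [Module ℝ V] [TopologicalSpace V]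
    [AddCommGroup V'] [Module ℝ V'] [TopologicalSpace V'] [AddCommGroup W] [Module ℝ W]
    [TopologicalSpace W] (B : W →L[ℝ] W →L[ℝ] ℝ) (e : V →L[ℝ] W) (e' : V' →L[ℝ] W) :
    V →L[ℝ] V' →L[ℝ] ℝ :=
  (e'.precomp ℝ).comp (B.comp e)

@[simp]
theorem pullBilin_apply {V V' W : Type*} [AddCommGroup V] [Module ℝ V] [TopologicalSpace V]
    [AddCommGroup V'] [Module ℝ V'] [TopologicalSpace V'] [AddCommGroup W] [Module ℝ W]
    [TopologicalSpace W] (B : W →L[ℝ] W →L[ℝ] ℝ) (e : V →L[ℝ] W) (e' : V' →L[ℝ] W)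
    (v : V) (w : V') : pullBilin B e e' v w = B (e v) (e' w) := rfl

section LeviCivita

/-- The Christoffel symbols (of the second kind) of a metric `γ = (γ_{ij})` on (an open subset of) a
normed space, as a bilinear map `Γ`:
`γ(Γ(v, w), z) = ½ ((∂_v γ)(w, z) + (∂_w γ)(v, z) - (∂_z γ)(v, w))`, solved for `Γ(v, w)` by means
of the inverse of `γ`; see `christoffelOf_spec`. -/
def christoffelOf {F : Type*} [NormedAddCommGroup F] [NormedSpace ℝ F]
    (γ : F → F →L[ℝ] F →L[ℝ] ℝ) (u : F) : F →L[ℝ] F →L[ℝ] F :=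
  let D : F →L[ℝ] F →L[ℝ] F →L[ℝ] ℝ := fderiv ℝ γ u
  let D' : F →L[ℝ] F →L[ℝ] F →L[ℝ] ℝ :=
    (ContinuousLinearMap.flipₗᵢ ℝ F F ℝ).toContinuousLinearEquiv.toContinuousLinearMap.comp D.flip
  (ContinuousLinearMap.compL ℝ F (F →L[ℝ] ℝ) F (γ u).inverse).comp
    ((1 / 2 : ℝ) • (D + D.flip - D'))

/-- The defining equation of the Christoffel symbols, wherever the metric is nondegenerate. -/
theorem christoffelOf_spec {F : Type*} [NormedAddCommGroup F] [NormedSpace ℝ F]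
    (γ : F → F →L[ℝ] F →L[ℝ] ℝ) (u : F) (hu : (γ u).IsInvertible) (v w z : F) :
    γ u (christoffelOf γ u v w) z
      = (1 / 2 : ℝ) * (fderiv ℝ γ u v w z + fderiv ℝ γ u w v z - fderiv ℝ γ u z v w) := by
  obtain ⟨e, he⟩ := hu
  simp only [christoffelOf, ← he, ContinuousLinearMap.inverse_equiv]
  simp

/- `N` is a manifold without boundary modelled on the normed space `F` (finite-dimensional
in the theorem).  The trivialization of the tangent bundle at `p` is the derivative of the preferred
chart at `p`; it is the identity on the fibre over `p` itself. -/
variable {F : Type*} [NormedAddCommGroup F] [NormedSpace ℝ F]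
  {H : Type*} [TopologicalSpace H] {I : ModelWithCorners ℝ F H}
  {N : Type*} [TopologicalSpace N] [ChartedSpace H N] [IsManifold I 1 N]

/-- The components `h_{ij}` of the (0,2)-tensor field `h` at the point with coordinates `u` in the
preferred chart at `p`, as a bilinear form on the model space. -/
def coordMetric (h : ∀ q : N, TangentSpace I q →L[ℝ] TangentSpace I q →L[ℝ] ℝ)
    (p : N) (u : F) : F →L[ℝ] F →L[ℝ] ℝ :=
  pullBilin (h ((extChartAt I p).symm u))
    ((trivializationAt F (TangentSpace I) p).symmL ℝ ((extChartAt I p).symm u))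
    ((trivializationAt F (TangentSpace I) p).symmL ℝ ((extChartAt I p).symm u))

/-- The Christoffel symbols (of the second kind) of `h` at the point with coordinates `u` in the
preferred chart at `p`, as a bilinear map on the model space. -/
def christoffel (h : ∀ q : N, TangentSpace I q →L[ℝ] TangentSpace I q →L[ℝ] ℝ)
    (p : N) (u : F) : F →L[ℝ] F →L[ℝ] F :=
  christoffelOf (coordMetric h p) u

/-- The coordinate expression, in the preferred chart at `p`, of a vector field `Y` on `N`. -/
def coordField (Y : ∀ q : N, TangentSpace I q) (p : N) (u : F) : F :=
  (trivializationAt F (TangentSpace I) p).continuousLinearMapAt ℝ ((extChartAt I p).symm u)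
    (Y ((extChartAt I p).symm u))

/-- The Levi-Civita connection of the metric `h`: `leviCivita h Y p v = ∇_v Y`, that is
`v^i (∂_i Y^k + Γ^k_{ij} Y^j) ∂_k`, computed in the preferred chart at `p`. -/
def leviCivita (h : ∀ q : N, TangentSpace I q →L[ℝ] TangentSpace I q →L[ℝ] ℝ)
    (Y : ∀ q : N, TangentSpace I q) (p : N) : TangentSpace I p →L[ℝ] TangentSpace I p :=
  (fderiv ℝ (coordField Y p) (extChartAt I p p)
    + (christoffel h p (extChartAt I p p)).flip (Y p) : F →L[ℝ] F)

/-- The vector field `∇_X Y`. -/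
def nabla (h : ∀ q : N, TangentSpace I q →L[ℝ] TangentSpace I q →L[ℝ] ℝ)
    (X Y : ∀ q : N, TangentSpace I q) : ∀ q : N, TangentSpace I q :=
  fun q => leviCivita h Y q (X q)

/-- The Riemann curvature tensor `R(X,Y)Z = ∇_X ∇_Y Z - ∇_Y ∇_X Z - ∇_{[X,Y]} Z` of `h`. -/
def curvature (h : ∀ q : N, TangentSpace I q →L[ℝ] TangentSpace I q →L[ℝ] ℝ)
    (X Y Z : ∀ q : N, TangentSpace I q) : ∀ q : N, TangentSpace I q :=
  nabla h X (nabla h Y Z) - nabla h Y (nabla h X Z) - nabla h (mlieBracket I X Y) Z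

/-- The covariant derivative `(∇_W R)(X,Y)Z` of the Riemann curvature tensor of `h`. -/
def nablaCurvature (h : ∀ q : N, TangentSpace I q →L[ℝ] TangentSpace I q →L[ℝ] ℝ)
    (W X Y Z : ∀ q : N, TangentSpace I q) : ∀ q : N, TangentSpace I q :=
  nabla h W (curvature h X Y Z) - curvature h (nabla h W X) Y Z
    - curvature h X (nabla h W Y) Z - curvature h X Y (nabla h W Z)

end LeviCivita

section TangentBundle

/- The tangent space of `TM` at `p = (x, y)` is `E × E`, the components being those with respect to
the coordinates `(x^i, y^i)` on `TM` induced by the preferred chart of `M` at `x`. -/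
variable {E : Type*} [NormedAddCommGroup E] [NormedSpace ℝ E]
  {H : Type*} [TopologicalSpace H] {I : ModelWithCorners ℝ E H}
  {M : Type*} [TopologicalSpace M] [ChartedSpace H M] [IsManifold I 1 M]

/-- The vertical lift `v^i ∂/∂y^i` to `p ∈ TM` of a tangent vector `v` at the base point of `p`. -/
def vlift (p : TangentBundle I M) (v : TangentSpace I p.proj) : TangentSpace I.tangent p :=
  ((0, v) : E × E)

/-- The horizontal lift `v^i (∂/∂x^i - y^a Γ^j_{ai} ∂/∂y^j)` to `p = (x, y) ∈ TM` of a tangent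
vector `v` at `x`. -/
def hlift (g : ∀ x : M, TangentSpace I x →L[ℝ] TangentSpace I x →L[ℝ] ℝ)
    (p : TangentBundle I M) (v : TangentSpace I p.proj) : TangentSpace I.tangent p :=
  ((v, - christoffel g p.proj (extChartAt I p.proj p.proj) p.2 v) : E × E)

/-- The horizontal component of a tangent vector of `TM` (the derivative of the projection). -/
def hpart (p : TangentBundle I M) : TangentSpace I.tangent p →L[ℝ] TangentSpace I p.proj :=
  ContinuousLinearMap.fst ℝ E E

/-- The vertical component of a tangent vector of `TM` (the connection map). -/
def vpart (g : ∀ x : M, TangentSpace I x →L[ℝ] TangentSpace I x →L[ℝ] ℝ)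
    (p : TangentBundle I M) : TangentSpace I.tangent p →L[ℝ] TangentSpace I p.proj :=
  (ContinuousLinearMap.snd ℝ E E
    + (christoffel g p.proj (extChartAt I p.proj p.proj) p.2).comp
        (ContinuousLinearMap.fst ℝ E E) : E × E →L[ℝ] E)

/-- The decomposition of a tangent vector of `TM` into its horizontal and vertical parts. -/
theorem hlift_hpart_add_vlift_vpart
    (g : ∀ x : M, TangentSpace I x →L[ℝ] TangentSpace I x →L[ℝ] ℝ)
    (p : TangentBundle I M) (ξ : TangentSpace I.tangent p) :
    hlift g p (hpart p ξ) + vlift p (vpart g p ξ) = ξ := by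
  refine Prod.ext ?_ ?_
  · exact add_zero (ξ : E × E).1
  · exact neg_add_cancel_comm_assoc _ _

theorem hpart_hlift (g : ∀ x : M, TangentSpace I x →L[ℝ] TangentSpace I x →L[ℝ] ℝ)
    (p : TangentBundle I M) (v : TangentSpace I p.proj) : hpart p (hlift g p v) = v := rfl

theorem hpart_vlift (p : TangentBundle I M) (v : TangentSpace I p.proj) :
    hpart p (vlift p v) = 0 := rfl

theorem vpart_hlift (g : ∀ x : M, TangentSpace I x →L[ℝ] TangentSpace I x →L[ℝ] ℝ)
    (p : TangentBundle I M) (v : TangentSpace I p.proj) : vpart g p (hlift g p v) = 0 :=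
  neg_add_cancel (christoffel g p.proj (extChartAt I p.proj p.proj) p.2 v)

theorem vpart_vlift (g : ∀ x : M, TangentSpace I x →L[ℝ] TangentSpace I x →L[ℝ] ℝ)
    (p : TangentBundle I M) (v : TangentSpace I p.proj) : vpart g p (vlift p v) = v := by
  have h (w : E) : w + christoffel g p.proj (extChartAt I p.proj p.proj) p.2 (0 : E) = w := by
    rw [map_zero, add_zero]
  exact h v

/-- The Sasaki lift `gˢ` of `g`. -/
def sasakiLift (g : ∀ x : M, TangentSpace I x →L[ℝ] TangentSpace I x →L[ℝ] ℝ)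
    (p : TangentBundle I M) :
    TangentSpace I.tangent p →L[ℝ] TangentSpace I.tangent p →L[ℝ] ℝ :=
  pullBilin (g p.proj) (hpart p) (hpart p) + pullBilin (g p.proj) (vpart g p) (vpart g p)

/-- The horizontal lift `gʰ` of `g`. -/
def horizontalLift (g : ∀ x : M, TangentSpace I x →L[ℝ] TangentSpace I x →L[ℝ] ℝ)
    (p : TangentBundle I M) :
    TangentSpace I.tangent p →L[ℝ] TangentSpace I.tangent p →L[ℝ] ℝ :=
  pullBilin (g p.proj) (hpart p) (vpart g p) + pullBilin (g p.proj) (vpart g p) (hpart p)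

/-- The vertical lift `gᵛ` of `g`. -/
def verticalLift (g : ∀ x : M, TangentSpace I x →L[ℝ] TangentSpace I x →L[ℝ] ℝ)
    (p : TangentBundle I M) :
    TangentSpace I.tangent p →L[ℝ] TangentSpace I.tangent p →L[ℝ] ℝ :=
  pullBilin (g p.proj) (hpart p) (hpart p)

/-- The `g`-natural metric `G = a gˢ + b gʰ + c gᵛ` on `TM`. -/
def gNatural (g : ∀ x : M, TangentSpace I x →L[ℝ] TangentSpace I x →L[ℝ] ℝ) (a b c : ℝ)
    (p : TangentBundle I M) :
    TangentSpace I.tangent p →L[ℝ] TangentSpace I.tangent p →L[ℝ] ℝ :=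
  a • sasakiLift g p + b • horizontalLift g p + c • verticalLift g p

theorem gNatural_hlift_hlift (g : ∀ x : M, TangentSpace I x →L[ℝ] TangentSpace I x →L[ℝ] ℝ)
    (a b c : ℝ) (p : TangentBundle I M) (v w : TangentSpace I p.proj) :
    gNatural g a b c p (hlift g p v) (hlift g p w) = (a + c) * g p.proj v w := by
  simp [gNatural, sasakiLift, horizontalLift, verticalLift, hpart_hlift, vpart_hlift]
  ring

theorem gNatural_hlift_vlift (g : ∀ x : M, TangentSpace I x →L[ℝ] TangentSpace I x →L[ℝ] ℝ)
    (a b c : ℝ) (p : TangentBundle I M) (v w : TangentSpace I p.proj) :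
    gNatural g a b c p (hlift g p v) (vlift p w) = b * g p.proj v w := by
  simp [gNatural, sasakiLift, horizontalLift, verticalLift, hpart_hlift, vpart_hlift, hpart_vlift,
    vpart_vlift]

theorem gNatural_vlift_hlift (g : ∀ x : M, TangentSpace I x →L[ℝ] TangentSpace I x →L[ℝ] ℝ)
    (a b c : ℝ) (p : TangentBundle I M) (v w : TangentSpace I p.proj) :
    gNatural g a b c p (vlift p v) (hlift g p w) = b * g p.proj v w := by
  simp [gNatural, sasakiLift, horizontalLift, verticalLift, hpart_hlift, vpart_hlift, hpart_vlift,
    vpart_vlift]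

theorem gNatural_vlift_vlift (g : ∀ x : M, TangentSpace I x →L[ℝ] TangentSpace I x →L[ℝ] ℝ)
    (a b c : ℝ) (p : TangentBundle I M) (v w : TangentSpace I p.proj) :
    gNatural g a b c p (vlift p v) (vlift p w) = a * g p.proj v w := by
  simp [gNatural, sasakiLift, horizontalLift, verticalLift, hpart_vlift, vpart_vlift]

/-- The horizontal lift `Xʰ` of a vector field `X` on `M`, a vector field on `TM`. -/
def hliftField (g : ∀ x : M, TangentSpace I x →L[ℝ] TangentSpace I x →L[ℝ] ℝ)
    (X : ∀ x : M, TangentSpace I x) : ∀ p : TangentBundle I M, TangentSpace I.tangent p :=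
  fun p => hlift g p (X p.proj)

end TangentBundle

end GNat

end

noncomputable section

namespace GNat

open Filter Topology

section Calculus

variable {E F G G' G'' : Type*} [NormedAddCommGroup E] [NormedSpace ℝ E]
  [NormedAddCommGroup F] [NormedSpace ℝ F] [NormedAddCommGroup G] [NormedSpace ℝ G]
  [NormedAddCommGroup G'] [NormedSpace ℝ G'] [NormedAddCommGroup G''] [NormedSpace ℝ G'']

theorem fderiv_apply_one {A : E → G →L[ℝ] F} {X : E → G} {u : E} (hA : DifferentiableAt ℝ A u)
    (hX : DifferentiableAt ℝ X u) (v : E) :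
    fderiv ℝ (fun u => A u (X u)) u v = fderiv ℝ A u v (X u) + A u (fderiv ℝ X u v) := by
  rw [fderiv_clm_apply hA hX]
  simp [add_comm]

theorem fderiv_apply_two {A : E → G →L[ℝ] G' →L[ℝ] F} {X : E → G} {Y : E → G'} {u : E}
    (hA : DifferentiableAt ℝ A u) (hX : DifferentiableAt ℝ X u) (hY : DifferentiableAt ℝ Y u)
    (v : E) :
    fderiv ℝ (fun u => A u (X u) (Y u)) u v = fderiv ℝ A u v (X u) (Y u)
      + A u (fderiv ℝ X u v) (Y u) + A u (X u) (fderiv ℝ Y u v) := by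
  rw [fderiv_apply_one (hA.clm_apply hX) hY, fderiv_apply_one hA hX]
  simp

theorem fderiv_apply_three {A : E → G →L[ℝ] G' →L[ℝ] G'' →L[ℝ] F} {X : E → G} {Y : E → G'}
    {Z : E → G''} {u : E} (hA : DifferentiableAt ℝ A u) (hX : DifferentiableAt ℝ X u)
    (hY : DifferentiableAt ℝ Y u) (hZ : DifferentiableAt ℝ Z u) (v : E) :
    fderiv ℝ (fun u => A u (X u) (Y u) (Z u)) u v = fderiv ℝ A u v (X u) (Y u) (Z u)
      + A u (fderiv ℝ X u v) (Y u) (Z u) + A u (X u) (fderiv ℝ Y u v) (Z u)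
      + A u (X u) (Y u) (fderiv ℝ Z u v) := by
  rw [fderiv_apply_two (hA.clm_apply hX) hY hZ, fderiv_apply_one hA hX]
  simp

theorem fderiv_fderiv_symm {f : E → F} {O : Set E} (hO : IsOpen O) (hf : ContDiffOn ℝ ∞ f O)
    {u : E} (hu : u ∈ O) (v w : E) :
    fderiv ℝ (fderiv ℝ f) u v w = fderiv ℝ (fderiv ℝ f) u w v :=
  (hf.contDiffAt (hO.mem_nhds hu)).isSymmSndFDerivAt
    (by simpa using (WithTop.coe_le_coe.2 le_top : ((2 : ℕ∞) : WithTop ℕ∞) ≤ ∞)) v w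

theorem contDiffOn_fderiv {f : E → F} {O : Set E} (hO : IsOpen O) (hf : ContDiffOn ℝ ∞ f O) :
    ContDiffOn ℝ ∞ (fderiv ℝ f) O :=
  hf.fderiv_of_isOpen hO (by simp)

theorem differentiableAt_of_contDiffOn {f : E → F} {O : Set E} (hO : IsOpen O)
    (hf : ContDiffOn ℝ ∞ f O) {u : E} (hu : u ∈ O) : DifferentiableAt ℝ f u :=
  (hf.contDiffAt (hO.mem_nhds hu)).differentiableAt (by simp)

theorem fderiv_eq_of_eqOn {f f' : E → F} {O : Set E} (hO : IsOpen O) (h : Set.EqOn f f' O)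
    {u : E} (hu : u ∈ O) : fderiv ℝ f u = fderiv ℝ f' u :=
  (h.eventuallyEq_of_mem (hO.mem_nhds hu)).fderiv_eq

end Calculus

section Affine

variable {F : Type*} [NormedAddCommGroup F] [NormedSpace ℝ F]

/-- The covariant derivative `∇_X Y` on a normed space with Christoffel symbols `Γ`. -/
def nablaOf (Γ : F → F →L[ℝ] F →L[ℝ] F) (X Y : F → F) (u : F) : F :=
  fderiv ℝ Y u (X u) + Γ u (X u) (Y u)

/-- The curvature tensor of the connection with Christoffel symbols `Γ`. -/
def curvatureOf (Γ : F → F →L[ℝ] F →L[ℝ] F) (u : F) : F →L[ℝ] F →L[ℝ] F →L[ℝ] F :=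
  let Q : F →L[ℝ] F →L[ℝ] F →L[ℝ] F :=
    ((ContinuousLinearMap.compL ℝ F (F →L[ℝ] F) (F →L[ℝ] F)).flip (Γ u)).comp
      ((ContinuousLinearMap.compL ℝ F F F).comp (Γ u))
  fderiv ℝ Γ u - (fderiv ℝ Γ u).flip + (Q - Q.flip)

theorem curvatureOf_apply (Γ : F → F →L[ℝ] F →L[ℝ] F) (u x y z : F) :
    curvatureOf Γ u x y z = fderiv ℝ Γ u x y z - fderiv ℝ Γ u y x z
      + (Γ u x (Γ u y z) - Γ u y (Γ u x z)) := by
  simp [curvatureOf]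

/-- The components of `(∇_w R)(x, y) z`. -/
def nablaCurvatureOf (Γ : F → F →L[ℝ] F →L[ℝ] F) (u w x y z : F) : F :=
  fderiv ℝ (curvatureOf Γ) u w x y z + Γ u w (curvatureOf Γ u x y z)
    - curvatureOf Γ u (Γ u w x) y z - curvatureOf Γ u x (Γ u w y) z
    - curvatureOf Γ u x y (Γ u w z)

theorem curvatureOf_antisymm (Γ : F → F →L[ℝ] F →L[ℝ] F) (u x y z : F) :
    curvatureOf Γ u x y z = - curvatureOf Γ u y x z := by
  simp only [curvatureOf_apply]
  abel

/-- Smooth symmetric (that is, torsion-free) Christoffel symbols on an open set. -/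
structure IsConnectionOn (Γ : F → F →L[ℝ] F →L[ℝ] F) (O : Set F) : Prop where
  isOpen : IsOpen O
  contDiffOn : ContDiffOn ℝ ∞ Γ O
  symm : ∀ u ∈ O, ∀ v w, Γ u v w = Γ u w v

namespace IsConnectionOn

variable {Γ : F → F →L[ℝ] F →L[ℝ] F} {O : Set F} {u : F}

theorem differentiableAt (h : IsConnectionOn Γ O) (hu : u ∈ O) : DifferentiableAt ℝ Γ u :=
  differentiableAt_of_contDiffOn h.isOpen h.contDiffOn hu

theorem differentiableAt_fderiv (h : IsConnectionOn Γ O) (hu : u ∈ O) :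
    DifferentiableAt ℝ (fderiv ℝ Γ) u :=
  differentiableAt_of_contDiffOn h.isOpen (contDiffOn_fderiv h.isOpen h.contDiffOn) hu

theorem contDiffOn_curvatureOf (h : IsConnectionOn Γ O) : ContDiffOn ℝ ∞ (curvatureOf Γ) O := by
  have h1 := h.contDiffOn
  have h2 := contDiffOn_fderiv h.isOpen h1
  have hflip : ContDiff ℝ ∞ (fun B : F →L[ℝ] F →L[ℝ] F →L[ℝ] F => B.flip) :=
    (ContinuousLinearMap.flipₗᵢ ℝ F F (F →L[ℝ] F)).contDiff
  have hQ : ContDiffOn ℝ ∞ (fun u =>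
      ((ContinuousLinearMap.compL ℝ F (F →L[ℝ] F) (F →L[ℝ] F)).flip (Γ u)).comp
      ((ContinuousLinearMap.compL ℝ F F F).comp (Γ u))) O := by
    fun_prop
  exact (h2.sub (hflip.comp_contDiffOn h2)).add (hQ.sub (hflip.comp_contDiffOn hQ))

theorem differentiableAt_curvatureOf (h : IsConnectionOn Γ O) (hu : u ∈ O) :
    DifferentiableAt ℝ (curvatureOf Γ) u :=
  differentiableAt_of_contDiffOn h.isOpen h.contDiffOn_curvatureOf hu

theorem contDiffOn_nablaOf (h : IsConnectionOn Γ O) {X Y : F → F} (hX : ContDiffOn ℝ ∞ X O)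
    (hY : ContDiffOn ℝ ∞ Y O) : ContDiffOn ℝ ∞ (nablaOf Γ X Y) O := by
  have h1 := h.contDiffOn
  have h2 := contDiffOn_fderiv h.isOpen hY
  exact (h2.clm_apply hX).add ((h1.clm_apply hX).clm_apply hY)

theorem fderiv_symm (h : IsConnectionOn Γ O) (hu : u ∈ O) (x v w : F) :
    fderiv ℝ Γ u x v w = fderiv ℝ Γ u x w v := by
  have hΓ := h.differentiableAt hu
  have e1 := fderiv_apply_two hΓ (differentiableAt_const v) (differentiableAt_const w) x
  have e2 := fderiv_apply_two hΓ (differentiableAt_const w) (differentiableAt_const v) x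
  rw [fderiv_eq_of_eqOn h.isOpen (fun u hu => h.symm u hu v w) hu] at e1
  simpa using e1.symm.trans e2

/-- The curvature of vector fields is given by the curvature tensor. -/
theorem nablaOf_curvature (h : IsConnectionOn Γ O) (hu : u ∈ O) {X Y Z : F → F}
    (hX : ContDiffOn ℝ ∞ X O) (hY : ContDiffOn ℝ ∞ Y O) (hZ : ContDiffOn ℝ ∞ Z O) :
    nablaOf Γ X (nablaOf Γ Y Z) u - nablaOf Γ Y (nablaOf Γ X Z) u
      - nablaOf Γ (nablaOf Γ X Y - nablaOf Γ Y X) Z u = curvatureOf Γ u (X u) (Y u) (Z u) := by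
  have key (V : F → F) (hV : ContDiffOn ℝ ∞ V O) (v : F) :
      fderiv ℝ (nablaOf Γ V Z) u v = fderiv ℝ (fderiv ℝ Z) u v (V u)
        + fderiv ℝ Z u (fderiv ℝ V u v) + (fderiv ℝ Γ u v (V u) (Z u)
        + Γ u (fderiv ℝ V u v) (Z u) + Γ u (V u) (fderiv ℝ Z u v)) := by
    have hΓ := h.differentiableAt hu
    have hV' := differentiableAt_of_contDiffOn h.isOpen hV hu
    have hZ' := differentiableAt_of_contDiffOn h.isOpen hZ hu
    have hZ'' := differentiableAt_of_contDiffOn h.isOpen (contDiffOn_fderiv h.isOpen hZ) hu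
    rw [← fderiv_apply_one hZ'' hV', ← fderiv_apply_two hΓ hV' hZ']
    unfold nablaOf
    rw [fderiv_fun_add (hZ''.clm_apply hV') ((hΓ.clm_apply hV').clm_apply hZ')]
    rfl
  rw [curvatureOf_apply]
  have e (V W : F → F) : nablaOf Γ V W u = fderiv ℝ W u (V u) + Γ u (V u) (W u) := rfl
  rw [e X, e Y (nablaOf Γ X Z), e _ Z, key Y hY, key X hX,
    fderiv_fderiv_symm h.isOpen hZ hu (X u) (Y u)]
  simp only [Pi.sub_apply, nablaOf, map_add, map_sub, add_apply,
    sub_apply, h.symm u hu (X u) (Y u)]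
  abel

theorem bianchi_first (h : IsConnectionOn Γ O) (hu : u ∈ O) (x y z : F) :
    curvatureOf Γ u x y z + curvatureOf Γ u y z x + curvatureOf Γ u z x y = 0 := by
  simp only [curvatureOf_apply, h.fderiv_symm hu x z y, h.fderiv_symm hu y x z,
    h.fderiv_symm hu z y x, h.symm u hu z x, h.symm u hu y x, h.symm u hu z y]
  abel

theorem fderiv_curvatureOf (h : IsConnectionOn Γ O) (hu : u ∈ O) (w x y z : F) :
    fderiv ℝ (curvatureOf Γ) u w x y z
      = fderiv ℝ (fderiv ℝ Γ) u w x y z - fderiv ℝ (fderiv ℝ Γ) u w y x z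
        + (fderiv ℝ Γ u w x (Γ u y z) + Γ u x (fderiv ℝ Γ u w y z)
        - (fderiv ℝ Γ u w y (Γ u x z) + Γ u y (fderiv ℝ Γ u w x z))) := by
  have hΓ := h.differentiableAt hu
  have hΓ' := h.differentiableAt_fderiv hu
  have c (v : F) : DifferentiableAt ℝ (fun _ : F => v) u := differentiableAt_const v
  have e := fderiv_apply_three (h.differentiableAt_curvatureOf hu) (c x) (c y) (c z) w
  simp only [curvatureOf_apply] at e
  have e1 (x y z : F) := fderiv_apply_three hΓ' (c x) (c y) (c z) w
  have e2 (y z : F) := fderiv_apply_two hΓ (c y) (c z) w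
  have d2 (y z : F) : DifferentiableAt ℝ (fun u => Γ u y z) u :=
    (hΓ.clm_apply (c y)).clm_apply (c z)
  have d3 (x y z : F) : DifferentiableAt ℝ (fun u => Γ u x (Γ u y z)) u :=
    (hΓ.clm_apply (c x)).clm_apply (d2 y z)
  have d1 (x y z : F) : DifferentiableAt ℝ (fun u => fderiv ℝ Γ u x y z) u :=
    ((hΓ'.clm_apply (c x)).clm_apply (c y)).clm_apply (c z)
  have e3 (x y z : F) := fderiv_apply_two hΓ (c x) (d2 y z) w
  rw [fderiv_fun_add ((d1 _ _ _).fun_sub (d1 _ _ _)) ((d3 _ _ _).fun_sub (d3 _ _ _)),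
    fderiv_fun_sub (d1 _ _ _) (d1 _ _ _), fderiv_fun_sub (d3 _ _ _) (d3 _ _ _)] at e
  simp only [add_apply, sub_apply, e1, e3, e2] at e
  simpa using e.symm

theorem bianchi_second (h : IsConnectionOn Γ O) (hu : u ∈ O) (w x y z : F) :
    nablaCurvatureOf Γ u w x y z + nablaCurvatureOf Γ u x y w z
      + nablaCurvatureOf Γ u y w x z = 0 := by
  simp only [nablaCurvatureOf, h.fderiv_curvatureOf hu]
  have hs (v w : F) := fderiv_fderiv_symm h.isOpen h.contDiffOn hu v w
  rw [hs x w, hs y x, hs y w]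
  simp only [h.symm u hu w x, h.symm u hu y x, h.symm u hu w y, curvatureOf_apply, map_add,
    map_sub]
  abel

theorem nablaCurvatureOf_antisymm (h : IsConnectionOn Γ O) (hu : u ∈ O) (w x y z : F) :
    nablaCurvatureOf Γ u w x y z = - nablaCurvatureOf Γ u w y x z := by
  simp only [nablaCurvatureOf, h.fderiv_curvatureOf hu, curvatureOf_antisymm Γ u x y,
    map_neg, curvatureOf_antisymm Γ u (Γ u w x) y, curvatureOf_antisymm Γ u x (Γ u w y)]
  abel

theorem nablaCurvatureOf_bianchi_first (h : IsConnectionOn Γ O) (hu : u ∈ O) (w x y z : F) :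
    nablaCurvatureOf Γ u w x y z + nablaCurvatureOf Γ u w y z x
      + nablaCurvatureOf Γ u w z x y = 0 := by
  have c (v : F) : DifferentiableAt ℝ (fun _ : F => v) u := differentiableAt_const v
  have hR := h.differentiableAt_curvatureOf hu
  have e (x y z : F) := fderiv_apply_three hR (c x) (c y) (c z) w
  have d (x y z : F) : DifferentiableAt ℝ (fun u => curvatureOf Γ u x y z) u :=
    ((hR.clm_apply (c x)).clm_apply (c y)).clm_apply (c z)
  have hD : fderiv ℝ (curvatureOf Γ) u w x y z + fderiv ℝ (curvatureOf Γ) u w y z x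
      + fderiv ℝ (curvatureOf Γ) u w z x y = 0 := by
    have e0 := congrArg (fun L => L w)
      (fderiv_eq_of_eqOn h.isOpen (fun u hu => h.bianchi_first hu x y z) hu)
    rw [fderiv_fun_add ((d _ _ _).fun_add (d _ _ _)) (d _ _ _), fderiv_fun_add (d _ _ _) (d _ _ _)]
      at e0
    simpa [e] using e0
  have b1 := h.bianchi_first hu (Γ u w x) y z
  have b2 := h.bianchi_first hu x (Γ u w y) z
  have b3 := h.bianchi_first hu x y (Γ u w z)
  have b := congrArg (Γ u w) (h.bianchi_first hu x y z)
  simp only [map_add, map_zero] at b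
  unfold nablaCurvatureOf
  linear_combination (norm := module) hD + b - b1 - b2 - b3

end IsConnectionOn

end Affine

/-- A four-linear expression with the antisymmetries and the cyclic identity of a curvature tensor
has the pair symmetry. -/
theorem pair_symm_of_bianchi {V : Type*} {T : V → V → V → V → ℝ}
    (h₁ : ∀ x y z w, T x y z w = - T y x z w)
    (h₂ : ∀ x y z w, T x y z w = - T x y w z)
    (h₃ : ∀ x y z w, T x y z w + T y z x w + T z x y w = 0) (x y z w : V) :
    T x y z w = T z w x y := by
  linarith [h₃ x y z w, h₃ y z w x, h₃ z w x y, h₃ w x y z, h₁ x y z w, h₁ y z x w, h₁ z x y w,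
    h₂ x y z w, h₂ y z x w, h₂ z x y w, h₁ y z w x, h₁ z w y x, h₁ w y z x, h₂ y z w x, h₂ z w y x,
    h₂ w y z x, h₁ z w x y, h₁ w x z y, h₁ x z w y, h₂ z w x y, h₂ w x z y, h₂ x z w y,
    h₁ w x y z, h₁ x y w z, h₁ y w x z, h₂ w x y z, h₂ x y w z, h₂ y w x z]

section Metric

variable {F : Type*} [NormedAddCommGroup F] [NormedSpace ℝ F]

/-- A bilinear form on a finite-dimensional space with trivial left kernel is invertible. -/
theorem isInvertible_of_nondegenerate [FiniteDimensional ℝ F] {B : F →L[ℝ] F →L[ℝ] ℝ}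
    (h : ∀ v, (∀ w, B v w = 0) → v = 0) : B.IsInvertible := by
  have hinj : Function.Injective B.toLinearMap := by
    rw [injective_iff_map_eq_zero]
    intro v hv
    refine h v fun w => ?_
    have : B v = 0 := hv
    simp [this]
  have hdim : Module.finrank ℝ F = Module.finrank ℝ (F →L[ℝ] ℝ) := by
    rw [← (LinearMap.toContinuousLinearMap (𝕜 := ℝ) (E := F) (F' := ℝ)).finrank_eq]
    exact (Subspace.dual_finrank_eq (K := ℝ) (V := F)).symm
  let e := (LinearMap.linearEquivOfInjective B.toLinearMap hinj hdim).toContinuousLinearEquiv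
  exact ⟨e, by ext v w; rfl⟩

/-- A smooth family of nondegenerate symmetric bilinear forms on an open set. -/
structure IsMetricOn (γ : F → F →L[ℝ] F →L[ℝ] ℝ) (O : Set F) : Prop where
  isOpen : IsOpen O
  contDiffOn : ContDiffOn ℝ ∞ γ O
  symm : ∀ u ∈ O, ∀ v w, γ u v w = γ u w v
  isInvertible : ∀ u ∈ O, (γ u).IsInvertible

namespace IsMetricOn

variable {γ : F → F →L[ℝ] F →L[ℝ] ℝ} {O : Set F} {u : F}

theorem differentiableAt (h : IsMetricOn γ O) (hu : u ∈ O) : DifferentiableAt ℝ γ u :=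
  differentiableAt_of_contDiffOn h.isOpen h.contDiffOn hu

theorem eq_of_apply_eq (h : IsMetricOn γ O) (hu : u ∈ O) {v w : F}
    (e : ∀ z, γ u v z = γ u w z) : v = w := by
  obtain ⟨A, hA⟩ := h.isInvertible u hu
  refine A.injective ?_
  have hA' (x : F) : A x = γ u x := congrArg (fun L => L x) hA
  rw [hA', hA']
  exact ContinuousLinearMap.ext e

theorem fderiv_symm (h : IsMetricOn γ O) (hu : u ∈ O) (x v w : F) :
    fderiv ℝ γ u x v w = fderiv ℝ γ u x w v := by
  have hγ := h.differentiableAt hu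
  have e1 := fderiv_apply_two hγ (differentiableAt_const v) (differentiableAt_const w) x
  have e2 := fderiv_apply_two hγ (differentiableAt_const w) (differentiableAt_const v) x
  rw [fderiv_eq_of_eqOn h.isOpen (fun u hu => h.symm u hu v w) hu] at e1
  simpa using e1.symm.trans e2

theorem christoffelOf_symm (h : IsMetricOn γ O) (hu : u ∈ O) (v w : F) :
    christoffelOf γ u v w = christoffelOf γ u w v := by
  refine h.eq_of_apply_eq hu fun z => ?_
  simp only [christoffelOf_spec γ u (h.isInvertible u hu), h.fderiv_symm hu z v w]
  ring

/-- The Levi-Civita connection is metric. -/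
theorem fderiv_apply (h : IsMetricOn γ O) (hu : u ∈ O) (x v w : F) :
    fderiv ℝ γ u x v w = γ u (christoffelOf γ u x v) w + γ u v (christoffelOf γ u x w) := by
  rw [h.symm u hu v]
  simp only [christoffelOf_spec γ u (h.isInvertible u hu), h.fderiv_symm hu x w v,
    h.fderiv_symm hu w x v, h.fderiv_symm hu v x w]
  ring

/-- The Levi-Civita connection is the only symmetric metric connection. -/
theorem christoffelOf_unique (h : IsMetricOn γ O) (hu : u ∈ O) {T : F → F → F}
    (hT : ∀ v w, T v w = T w v)
    (hT' : ∀ x v w, fderiv ℝ γ u x v w = γ u (T x v) w + γ u v (T x w)) (v w : F) :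
    christoffelOf γ u v w = T v w := by
  refine h.eq_of_apply_eq hu fun z => ?_
  rw [christoffelOf_spec γ u (h.isInvertible u hu), hT' v, hT' w, hT' z, hT w v, hT z v, hT z w,
    h.symm u hu (T v z) w]
  ring

theorem contDiffOn_christoffelOf [CompleteSpace F] (h : IsMetricOn γ O) :
    ContDiffOn ℝ ∞ (christoffelOf γ) O := by
  have h1 := contDiffOn_fderiv h.isOpen h.contDiffOn
  have h2 : ContDiffOn ℝ ∞ (fun u => (γ u).inverse) O := fun u hu =>
    ((h.isInvertible u hu).contDiffAt_map_inverse).comp_contDiffWithinAt u (h.contDiffOn u hu)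
  have hflip : ContDiff ℝ ∞ (fun B : F →L[ℝ] F →L[ℝ] F →L[ℝ] ℝ => B.flip) :=
    (ContinuousLinearMap.flipₗᵢ ℝ F F (F →L[ℝ] ℝ)).contDiff
  have h3 := hflip.comp_contDiffOn h1
  have h4 : ContDiffOn ℝ ∞ (fun u => (ContinuousLinearMap.compL ℝ F (F →L[ℝ] ℝ) F (γ u).inverse)) O :=
    (ContinuousLinearMap.contDiff _).comp_contDiffOn h2
  exact h4.clm_comp (contDiffOn_const.fun_smul
    ((h1.add h3).sub (contDiffOn_const.clm_comp h3)))

theorem isConnectionOn [CompleteSpace F] (h : IsMetricOn γ O) :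
    IsConnectionOn (christoffelOf γ) O :=
  ⟨h.isOpen, h.contDiffOn_christoffelOf, fun _ hu => h.christoffelOf_symm hu⟩

theorem curvatureOf_skew [CompleteSpace F] (h : IsMetricOn γ O) (hu : u ∈ O) (x y v w : F) :
    γ u (curvatureOf (christoffelOf γ) u x y v) w
      = - γ u v (curvatureOf (christoffelOf γ) u x y w) := by
  set Γ := christoffelOf γ with hΓ
  have hd := h.isConnectionOn.differentiableAt hu
  have hγ := h.differentiableAt hu
  have hγ' := differentiableAt_of_contDiffOn h.isOpen (contDiffOn_fderiv h.isOpen h.contDiffOn) hu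
  have c (v : F) : DifferentiableAt ℝ (fun _ : F => v) u := differentiableAt_const v
  have d (x v : F) : DifferentiableAt ℝ (fun u => Γ u x v) u := (hd.clm_apply (c x)).clm_apply (c v)
  have key (x y : F) : fderiv ℝ (fderiv ℝ γ) u x y v w
      = fderiv ℝ γ u x (Γ u y v) w + γ u (fderiv ℝ Γ u x y v) w
        + (fderiv ℝ γ u x v (Γ u y w) + γ u v (fderiv ℝ Γ u x y w)) := by
    have e := congrArg (fun L => L x)
      (fderiv_eq_of_eqOn h.isOpen (fun u hu => h.fderiv_apply hu y v w) hu)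
    rw [fderiv_fun_add ((hγ.clm_apply (d y v)).clm_apply (c w))
      ((hγ.clm_apply (c v)).clm_apply (d y w))] at e
    simp only [add_apply, fderiv_apply_three hγ' (c y) (c v) (c w)] at e
    rw [fderiv_apply_two hγ (d y v) (c w), fderiv_apply_two hγ (c v) (d y w),
      fderiv_apply_two hd (c y) (c v), fderiv_apply_two hd (c y) (c w)] at e
    simpa using e
  have hs := congrArg (fun L => L v w) (fderiv_fderiv_symm h.isOpen h.contDiffOn hu x y)
  simp only [key, h.fderiv_apply hu] at hs
  simp only [curvatureOf_apply, map_add, map_sub, add_apply, sub_apply]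
  linarith

theorem nablaCurvatureOf_skew [CompleteSpace F] (h : IsMetricOn γ O) (hu : u ∈ O)
    (m x y v w : F) :
    γ u (nablaCurvatureOf (christoffelOf γ) u m x y v) w
      = - γ u v (nablaCurvatureOf (christoffelOf γ) u m x y w) := by
  set Γ := christoffelOf γ with hΓ
  have hd := h.isConnectionOn.differentiableAt_curvatureOf hu
  have hγ := h.differentiableAt hu
  have c (v : F) : DifferentiableAt ℝ (fun _ : F => v) u := differentiableAt_const v
  have d (x y v : F) : DifferentiableAt ℝ (fun u => curvatureOf Γ u x y v) u :=
    ((hd.clm_apply (c x)).clm_apply (c y)).clm_apply (c v)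
  have e := congrArg (fun L => L m)
    (fderiv_eq_of_eqOn h.isOpen (fun u hu => h.curvatureOf_skew hu x y v w) hu)
  rw [fderiv_fun_neg] at e
  simp only [neg_apply] at e
  rw [fderiv_apply_two hγ (d x y v) (c w), fderiv_apply_two hγ (c v) (d x y w),
    fderiv_apply_three hd (c x) (c y) (c v), fderiv_apply_three hd (c x) (c y) (c w)] at e
  simp only [fderiv_fun_const, Pi.zero_apply, zero_apply, map_zero, add_zero,
    h.fderiv_apply hu] at e
  simp only [nablaCurvatureOf, map_add, map_sub, add_apply, sub_apply]
  linarith [h.curvatureOf_skew hu (Γ u m x) y v w, h.curvatureOf_skew hu x (Γ u m y) v w,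
    h.curvatureOf_skew hu x y (Γ u m v) w, h.curvatureOf_skew hu x y v (Γ u m w)]

theorem curvatureOf_pair_symm [CompleteSpace F] (h : IsMetricOn γ O) (hu : u ∈ O)
    (x y z w : F) :
    γ u (curvatureOf (christoffelOf γ) u x y z) w
      = γ u (curvatureOf (christoffelOf γ) u z w x) y := by
  refine pair_symm_of_bianchi (T := fun x y z w => γ u (curvatureOf (christoffelOf γ) u x y z) w)
    (fun x y z w => ?_) (fun x y z w => ?_) (fun x y z w => ?_) x y z w
  · simp only [curvatureOf_antisymm _ u x y, map_neg, neg_apply]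
  · rw [h.curvatureOf_skew hu, h.symm u hu]
  · simp only [← add_apply, ← map_add, h.isConnectionOn.bianchi_first hu, map_zero, zero_apply]

theorem nablaCurvatureOf_pair_symm [CompleteSpace F] (h : IsMetricOn γ O) (hu : u ∈ O)
    (m x y z w : F) :
    γ u (nablaCurvatureOf (christoffelOf γ) u m x y z) w
      = γ u (nablaCurvatureOf (christoffelOf γ) u m z w x) y := by
  refine pair_symm_of_bianchi
    (T := fun x y z w => γ u (nablaCurvatureOf (christoffelOf γ) u m x y z) w)
    (fun x y z w => ?_) (fun x y z w => ?_) (fun x y z w => ?_) x y z w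
  · simp only [h.isConnectionOn.nablaCurvatureOf_antisymm hu m x y, map_neg, neg_apply]
  · rw [h.nablaCurvatureOf_skew hu, h.symm u hu]
  · simp only [← add_apply, ← map_add, h.isConnectionOn.nablaCurvatureOf_bianchi_first hu,
      map_zero, zero_apply]

theorem nablaCurvatureOf_sub [CompleteSpace F] (h : IsMetricOn γ O) (hu : u ∈ O)
    (x y z t : F) :
    nablaCurvatureOf (christoffelOf γ) u x z t y - nablaCurvatureOf (christoffelOf γ) u y z t x
      = nablaCurvatureOf (christoffelOf γ) u z x y t
        - nablaCurvatureOf (christoffelOf γ) u t x y z := by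
  refine h.eq_of_apply_eq hu fun w => ?_
  set D := nablaCurvatureOf (christoffelOf γ) u
  have hc := h.isConnectionOn
  have p (m x y z w : F) : γ u (D m x y z) w = γ u (D m z w x) y :=
    h.nablaCurvatureOf_pair_symm hu m x y z w
  have b (m x y z w : F) : γ u (D m x y z) w + γ u (D x y m z) w + γ u (D y m x z) w = 0 := by
    simp only [← add_apply, ← map_add, D, hc.bianchi_second hu, map_zero, zero_apply]
  have a (m x y z w : F) : γ u (D m x y z) w = - γ u (D m y x z) w := by
    simp only [D, hc.nablaCurvatureOf_antisymm hu m x y, map_neg, neg_apply]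
  simp only [map_sub, sub_apply]
  linarith [p x z t y w, p y z t x w, b x y w z t, a y w x z t, b w z t x y, p w z t x y,
    p z t w x y, p t w z x y, a z t w x y, p z w t x y, a w x y z t, p z x y t w, p t x y z w,
    p t z w x y, a t w z x y, p w x y z t]

end IsMetricOn

/-- The transformation law of the Christoffel symbols under a change of coordinates `φ`. -/
theorem christoffelOf_transform {γ γ' : F → F →L[ℝ] F →L[ℝ] ℝ} {O O' : Set F}
    (h : IsMetricOn γ O) (h' : IsMetricOn γ' O') {φ : F → F} {u : F} (hu : u ∈ O)
    (hu' : φ u ∈ O') (hφ : ContDiffAt ℝ ∞ φ u)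
    (hφ' : Function.Surjective (fderiv ℝ φ u))
    (heq : ∀ᶠ w in 𝓝 u, ∀ x y, γ w x y = γ' (φ w) (fderiv ℝ φ w x) (fderiv ℝ φ w y)) (x y : F) :
    fderiv ℝ φ u (christoffelOf γ u x y) = fderiv ℝ (fderiv ℝ φ) u x y
      + christoffelOf γ' (φ u) (fderiv ℝ φ u x) (fderiv ℝ φ u y) := by
  have hd : DifferentiableAt ℝ φ u := hφ.differentiableAt (by simp)
  have hd' : DifferentiableAt ℝ (fderiv ℝ φ) u :=
    (hφ.fderiv_right (m := 1)
      (WithTop.coe_le_coe.2 le_top : ((2 : ℕ∞) : WithTop ℕ∞) ≤ ∞)).differentiableAt (by simp)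
  have hsymm (v w : F) : fderiv ℝ (fderiv ℝ φ) u v w = fderiv ℝ (fderiv ℝ φ) u w v :=
    hφ.isSymmSndFDerivAt
      (by simpa using (WithTop.coe_le_coe.2 le_top : ((2 : ℕ∞) : WithTop ℕ∞) ≤ ∞)) v w
  have hγ' := h'.differentiableAt hu'
  have c (v : F) : DifferentiableAt ℝ (fun _ : F => v) u := differentiableAt_const v
  have key (x y z : F) : fderiv ℝ γ u x y z
      = fderiv ℝ γ' (φ u) (fderiv ℝ φ u x) (fderiv ℝ φ u y) (fderiv ℝ φ u z)
        + γ' (φ u) (fderiv ℝ (fderiv ℝ φ) u x y) (fderiv ℝ φ u z)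
        + γ' (φ u) (fderiv ℝ φ u y) (fderiv ℝ (fderiv ℝ φ) u x z) := by
    have e1 : (fun w => γ w y z) =ᶠ[𝓝 u]
        fun w => γ' (φ w) (fderiv ℝ φ w y) (fderiv ℝ φ w z) := heq.mono fun w hw => hw y z
    have e := congrArg (fun L => L x) (e1.fderiv_eq (𝕜 := ℝ))
    rw [fderiv_apply_two (h.differentiableAt hu) (c y) (c z),
      fderiv_apply_two (A := fun w => γ' (φ w)) (hγ'.comp u hd) (hd'.clm_apply (c y))
        (hd'.clm_apply (c z)),
      fderiv_apply_one hd' (c y), fderiv_apply_one hd' (c z)] at e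
    have e2 : fderiv ℝ (fun w => γ' (φ w)) u x = fderiv ℝ γ' (φ u) (fderiv ℝ φ u x) := by
      have := fderiv_comp (𝕜 := ℝ) u hγ' hd
      rw [show (fun w => γ' (φ w)) = γ' ∘ φ from rfl, this]
      rfl
    rw [e2] at e
    simpa using e
  refine h'.eq_of_apply_eq hu' fun z => ?_
  obtain ⟨z, rfl⟩ := hφ' z
  rw [← heq.self_of_nhds, christoffelOf_spec γ u (h.isInvertible u hu), key, key, key, map_add,
    add_apply, christoffelOf_spec γ' (φ u) (h'.isInvertible _ hu'), hsymm y x, hsymm z x,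
    hsymm z y, h'.symm _ hu' (fderiv ℝ φ u x) (fderiv ℝ (fderiv ℝ φ) u y z),
    h'.symm _ hu' (fderiv ℝ φ u y) (fderiv ℝ (fderiv ℝ φ) u x z)]
  ring

end Metric

section FlatGNatural

variable {E : Type*} [NormedAddCommGroup E] [NormedSpace ℝ E]

/-- The vertical component of a vector at `p = (x, y)` in induced coordinates. -/
def verOf (Γ : E → E →L[ℝ] E →L[ℝ] E) (p : E × E) : E × E →L[ℝ] E :=
  ContinuousLinearMap.snd ℝ E E + (Γ p.1 p.2).comp (ContinuousLinearMap.fst ℝ E E)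

@[simp]
theorem verOf_apply (Γ : E → E →L[ℝ] E →L[ℝ] E) (p ξ : E × E) :
    verOf Γ p ξ = ξ.2 + Γ p.1 p.2 ξ.1 := rfl

/-- The `g`-natural metric in induced coordinates. -/
def gNaturalOf (γ : E → E →L[ℝ] E →L[ℝ] ℝ) (a b c : ℝ) (p : E × E) :
    E × E →L[ℝ] E × E →L[ℝ] ℝ :=
  let h := ContinuousLinearMap.fst ℝ E E
  let k := verOf (christoffelOf γ) p
  a • (pullBilin (γ p.1) h h + pullBilin (γ p.1) k k)
    + b • (pullBilin (γ p.1) h k + pullBilin (γ p.1) k h) + c • pullBilin (γ p.1) h h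

theorem gNaturalOf_apply (γ : E → E →L[ℝ] E →L[ℝ] ℝ) (a b c : ℝ) (p ξ η : E × E) :
    gNaturalOf γ a b c p ξ η = (a + c) * γ p.1 ξ.1 η.1
      + b * (γ p.1 ξ.1 (verOf (christoffelOf γ) p η) + γ p.1 (verOf (christoffelOf γ) p ξ) η.1)
      + a * γ p.1 (verOf (christoffelOf γ) p ξ) (verOf (christoffelOf γ) p η) := by
  simp only [gNaturalOf, add_apply, smul_apply, pullBilin_apply, ContinuousLinearMap.coe_fst',
    smul_eq_mul]
  ring

theorem contDiffOn_pullBilin {V W : Type*} [NormedAddCommGroup V] [NormedSpace ℝ V]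
    [NormedAddCommGroup W] [NormedSpace ℝ W] {O : Set V} {B : V → W →L[ℝ] W →L[ℝ] ℝ}
    {e e' : V → V →L[ℝ] W} (hB : ContDiffOn ℝ ∞ B O) (he : ContDiffOn ℝ ∞ e O)
    (he' : ContDiffOn ℝ ∞ e' O) : ContDiffOn ℝ ∞ (fun p => pullBilin (B p) (e p) (e' p)) O := by
  have h : ContDiff ℝ ∞ (fun A : V →L[ℝ] W => A.precomp ℝ) :=
    ((ContinuousLinearMap.compL ℝ V W ℝ).flip).contDiff
  exact (h.comp_contDiffOn he').clm_comp (hB.clm_comp he)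

theorem isMetricOn_gNaturalOf [FiniteDimensional ℝ E] {γ : E → E →L[ℝ] E →L[ℝ] ℝ} {O : Set E}
    (h : IsMetricOn γ O) {a b c : ℝ} (ha : a ≠ 0) (hα : a * (a + c) - b ^ 2 ≠ 0) :
    IsMetricOn (gNaturalOf γ a b c) (O ×ˢ Set.univ) := by
  have := FiniteDimensional.complete ℝ E
  have hfst : Set.MapsTo (Prod.fst : E × E → E) (O ×ˢ Set.univ) O := fun p hp => hp.1
  refine ⟨h.isOpen.prod isOpen_univ, ?_, fun p hp ξ η => ?_, fun p hp => ?_⟩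
  · have h1 : ContDiffOn ℝ ∞ (fun p : E × E => γ p.1) (O ×ˢ Set.univ) :=
      h.contDiffOn.comp contDiffOn_fst hfst
    have h2 : ContDiffOn ℝ ∞ (fun p : E × E => christoffelOf γ p.1) (O ×ˢ Set.univ) :=
      h.contDiffOn_christoffelOf.comp contDiffOn_fst hfst
    have hk : ContDiffOn ℝ ∞ (verOf (christoffelOf γ)) (O ×ˢ Set.univ) :=
      contDiffOn_const.add ((h2.clm_apply contDiffOn_snd).clm_comp contDiffOn_const)
    have hh : ContDiffOn ℝ ∞ (fun _ : E × E => ContinuousLinearMap.fst ℝ E E) (O ×ˢ Set.univ) :=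
      contDiffOn_const
    exact ((contDiffOn_const.fun_smul ((contDiffOn_pullBilin h1 hh hh).add
      (contDiffOn_pullBilin h1 hk hk))).add (contDiffOn_const.fun_smul
      ((contDiffOn_pullBilin h1 hh hk).add (contDiffOn_pullBilin h1 hk hh)))).add
      (contDiffOn_const.fun_smul (contDiffOn_pullBilin h1 hh hh))
  · rw [gNaturalOf_apply, gNaturalOf_apply, h.symm p.1 hp.1 ξ.1 η.1,
      h.symm p.1 hp.1 ξ.1 (verOf _ p η), h.symm p.1 hp.1 (verOf _ p ξ) η.1,
      h.symm p.1 hp.1 (verOf _ p ξ) (verOf _ p η)]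
    ring
  · refine isInvertible_of_nondegenerate fun ξ hξ => ?_
    have e1 (w : E) := hξ (w, - christoffelOf γ p.1 p.2 w)
    have e2 (w : E) := hξ (0, w)
    simp only [gNaturalOf_apply, verOf_apply, neg_add_cancel, map_zero, add_zero, mul_zero,
      zero_add] at e1 e2
    have hP : ξ.1 = 0 := h.eq_of_apply_eq hp.1 fun z => by
      have : (a * (a + c) - b ^ 2) * γ p.1 ξ.1 z = 0 := by
        linear_combination a * e1 z - b * e2 z
      simpa [hα] using this
    simp only [hP, map_zero, zero_apply, mul_zero, zero_add, add_zero] at e2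
    have hQ : ξ.2 = 0 := h.eq_of_apply_eq hp.1 fun z => by simpa [ha] using e2 z
    exact Prod.ext hP hQ

/-- The horizontal part of the difference between the Levi-Civita connection of the `g`-natural
metric and the horizontal connection, on the vectors with components `(x, x₁)` and `(v, v₁)`. -/
def corrH (a b α : ℝ) (R : E →L[ℝ] E →L[ℝ] E →L[ℝ] E) (t x x₁ v v₁ : E) : E :=
  -((a * b / (2 * α)) • (R x t v + R v t x)) - (a ^ 2 / (2 * α)) • (R v₁ t x + R x₁ t v)

/-- The vertical part of the difference between the Levi-Civita connection of the `g`-natural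
metric and the horizontal connection, on the vectors with components `(x, x₁)` and `(v, v₁)`. -/
def corrV (a b c α : ℝ) (R : E →L[ℝ] E →L[ℝ] E →L[ℝ] E) (t x x₁ v v₁ : E) : E :=
  (b ^ 2 / α) • R x t v - (a * (a + c) / (2 * α)) • R x v t
    + (a * b / (2 * α)) • (R v₁ t x + R x₁ t v)

theorem lower_corr_vert {a b c α : ℝ} (hα : α = a * (a + c) - b ^ 2) (hα₀ : α ≠ 0)
    {R : E →L[ℝ] E →L[ℝ] E →L[ℝ] E} {t x v : E} (hR : R x t v - R v t x = R x v t) (x' v' : E) :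
    b • corrH a b α R t x x' v v' + a • corrV a b c α R t x x' v v' = -((a / 2) • R x v t) := by
  have hR' : R v t x = R x t v - R x v t := by rw [← hR]; abel
  unfold corrH corrV
  rw [hR']
  match_scalars <;> field_simp <;> rw [hα] <;> ring

theorem lower_corr_hor {a b c α : ℝ} (hα : α = a * (a + c) - b ^ 2) (hα₀ : α ≠ 0)
    {R : E →L[ℝ] E →L[ℝ] E →L[ℝ] E} {t x v : E} (hR : R x t v - R v t x = R x v t) (x' v' : E) :
    (a + c) • corrH a b α R t x x' v v' + b • corrV a b c α R t x x' v v'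
      = -(b • R x t v) - (a / 2) • (R v' t x + R x' t v) := by
  have hR' : R v t x = R x t v - R x v t := by rw [← hR]; abel
  unfold corrH corrV
  rw [hR']
  match_scalars <;> field_simp <;> rw [hα] <;> ring

/-- The vector with horizontal component `A` and vertical component `B` in induced coordinates. -/
def liftOf (Γ : E → E →L[ℝ] E →L[ℝ] E) (p : E × E) (A B : E) : E × E :=
  (A, B - Γ p.1 p.2 A)

theorem verOf_liftOf (Γ : E → E →L[ℝ] E →L[ℝ] E) (p : E × E) (A B : E) :
    verOf Γ p (liftOf Γ p A B) = B := by
  simp [liftOf]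

theorem fderiv_comp_fst {G : Type*} [NormedAddCommGroup G] [NormedSpace ℝ G] {f : E → G}
    {p : E × E} (hf : DifferentiableAt ℝ f p.1) (ζ : E × E) :
    fderiv ℝ (fun p : E × E => f p.1) p ζ = fderiv ℝ f p.1 ζ.1 := by
  have := fderiv_comp (𝕜 := ℝ) p hf differentiableAt_fst
  rw [show (fun p : E × E => f p.1) = f ∘ Prod.fst from rfl, this]
  simp [fderiv_fst]

theorem fderiv_snd_apply (p ζ : E × E) : fderiv ℝ (fun p : E × E => p.2) p ζ = ζ.2 := by
  simp [fderiv_snd]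

theorem fderiv_verOf {Γ : E → E →L[ℝ] E →L[ℝ] E} {p : E × E} (hΓ : DifferentiableAt ℝ Γ p.1)
    (ξ ζ : E × E) : DifferentiableAt ℝ (fun p => verOf Γ p ξ) p ∧
      fderiv ℝ (fun p => verOf Γ p ξ) p ζ = fderiv ℝ Γ p.1 ζ.1 p.2 ξ.1 + Γ p.1 ζ.2 ξ.1 := by
  have h1 : DifferentiableAt ℝ (fun p : E × E => Γ p.1) p := hΓ.comp p differentiableAt_fst
  have h2 : DifferentiableAt ℝ (fun p : E × E => Γ p.1 p.2 ξ.1) p :=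
    (h1.clm_apply differentiableAt_snd).clm_apply (differentiableAt_const _)
  simp only [verOf_apply]
  refine ⟨h2.const_add _, ?_⟩
  rw [fderiv_const_add, fderiv_apply_two h1 differentiableAt_snd (differentiableAt_const _),
    fderiv_comp_fst hΓ, fderiv_snd_apply]
  simp

variable [FiniteDimensional ℝ E] {γ : E → E →L[ℝ] E →L[ℝ] ℝ} {O : Set E} {a b c α : ℝ}

theorem fderiv_gNaturalOf (h : IsMetricOn γ O) (ha : a ≠ 0) (hα : a * (a + c) - b ^ 2 ≠ 0)
    {p : E × E} (hp : p.1 ∈ O) (ζ ξ η : E × E) :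
    fderiv ℝ (gNaturalOf γ a b c) p ζ ξ η
      = (a + c) * fderiv ℝ γ p.1 ζ.1 ξ.1 η.1
        + b * (fderiv ℝ γ p.1 ζ.1 ξ.1 (verOf (christoffelOf γ) p η)
          + γ p.1 ξ.1 (fderiv ℝ (fun p => verOf (christoffelOf γ) p η) p ζ)
          + fderiv ℝ γ p.1 ζ.1 (verOf (christoffelOf γ) p ξ) η.1
          + γ p.1 (fderiv ℝ (fun p => verOf (christoffelOf γ) p ξ) p ζ) η.1)
        + a * (fderiv ℝ γ p.1 ζ.1 (verOf (christoffelOf γ) p ξ) (verOf (christoffelOf γ) p η)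
          + γ p.1 (fderiv ℝ (fun p => verOf (christoffelOf γ) p ξ) p ζ)
            (verOf (christoffelOf γ) p η)
          + γ p.1 (verOf (christoffelOf γ) p ξ)
            (fderiv ℝ (fun p => verOf (christoffelOf γ) p η) p ζ)) := by
  have := FiniteDimensional.complete ℝ E
  have hG := (isMetricOn_gNaturalOf h ha hα).differentiableAt (u := p) ⟨hp, trivial⟩
  have hΓ := h.isConnectionOn.differentiableAt hp
  have hγ := h.differentiableAt hp
  have hγ' : DifferentiableAt ℝ (fun p : E × E => γ p.1) p := hγ.comp p differentiableAt_fst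
  have hk (ξ : E × E) := (fderiv_verOf hΓ ξ 0).1
  have e (v : E) : DifferentiableAt ℝ (fun _ : E × E => v) p := differentiableAt_const v
  have h0 := fderiv_apply_two hG (differentiableAt_const ξ) (differentiableAt_const η) ζ
  simp only [fderiv_fun_const, Pi.zero_apply, zero_apply, map_zero, add_zero] at h0
  rw [← h0]
  simp only [gNaturalOf_apply]
  have d {A B : E × E → E} (hA : DifferentiableAt ℝ A p) (hB : DifferentiableAt ℝ B p) :
      DifferentiableAt ℝ (fun p => γ p.1 (A p) (B p)) p := (hγ'.clm_apply hA).clm_apply hB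
  rw [fderiv_fun_add (((d (e _) (e _)).const_mul _).fun_add
      (((d (e _) (hk η)).fun_add (d (hk ξ) (e _))).const_mul _)) ((d (hk ξ) (hk η)).const_mul _),
    fderiv_fun_add ((d (e _) (e _)).const_mul _)
      (((d (e _) (hk η)).fun_add (d (hk ξ) (e _))).const_mul _),
    fderiv_const_mul (d (e _) (e _)),
    fderiv_const_mul ((d (e _) (hk η)).fun_add (d (hk ξ) (e _))),
    fderiv_const_mul (d (hk ξ) (hk η)), fderiv_fun_add (d (e _) (hk η)) (d (hk ξ) (e _))]
  simp only [add_apply, smul_apply, smul_eq_mul]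
  rw [fderiv_apply_two hγ' (e _) (e _), fderiv_apply_two hγ' (e _) (hk η),
    fderiv_apply_two hγ' (hk ξ) (e _), fderiv_apply_two hγ' (hk ξ) (hk η), fderiv_comp_fst hγ]
  simp only [fderiv_fun_const, Pi.zero_apply, zero_apply, map_zero, add_zero]
  ring

/-- The Christoffel symbols of the `g`-natural metric. -/
theorem christoffelOf_gNaturalOf (h : IsMetricOn γ O) (ha : a ≠ 0)
    (hα : α = a * (a + c) - b ^ 2) (hα₀ : α ≠ 0) {p : E × E} (hp : p.1 ∈ O) (ξ η : E × E) :
    christoffelOf (gNaturalOf γ a b c) p ξ η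
      = liftOf (christoffelOf γ) p
          (christoffelOf γ p.1 ξ.1 η.1
            + corrH a b α (curvatureOf (christoffelOf γ) p.1) p.2 ξ.1
              (verOf (christoffelOf γ) p ξ) η.1 (verOf (christoffelOf γ) p η))
          (fderiv ℝ (fun p => verOf (christoffelOf γ) p η) p ξ
            + christoffelOf γ p.1 ξ.1 (verOf (christoffelOf γ) p η)
            + corrV a b c α (curvatureOf (christoffelOf γ) p.1) p.2 ξ.1
              (verOf (christoffelOf γ) p ξ) η.1 (verOf (christoffelOf γ) p η)) := by
  have := FiniteDimensional.complete ℝ E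
  have hG := isMetricOn_gNaturalOf h ha (hα ▸ hα₀)
  have hc := h.isConnectionOn
  have hΓ := hc.differentiableAt hp
  set Γ := christoffelOf γ with hΓdef
  set R := curvatureOf Γ p.1 with hR
  have hB (x t v : E) : R x t v - R v t x = R x v t := by
    have := hc.bianchi_first hp x t v
    rw [curvatureOf_antisymm _ _ t v, curvatureOf_antisymm _ _ v x] at this
    linear_combination (norm := module) this
  refine hG.christoffelOf_unique (u := p) ⟨hp, trivial⟩
    (T := fun ξ η => liftOf Γ p (Γ p.1 ξ.1 η.1 + corrH a b α R p.2 ξ.1 (verOf Γ p ξ) η.1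
      (verOf Γ p η)) (fderiv ℝ (fun p => verOf Γ p η) p ξ + Γ p.1 ξ.1 (verOf Γ p η)
        + corrV a b c α R p.2 ξ.1 (verOf Γ p ξ) η.1 (verOf Γ p η)))
    (fun ξ η => ?_) (fun ζ ξ η => ?_) ξ η
  · have e1 : corrH a b α R p.2 ξ.1 (verOf Γ p ξ) η.1 (verOf Γ p η)
        = corrH a b α R p.2 η.1 (verOf Γ p η) ξ.1 (verOf Γ p ξ) := by
      unfold corrH
      module
    have e2 : corrV a b c α R p.2 ξ.1 (verOf Γ p ξ) η.1 (verOf Γ p η) + R ξ.1 η.1 p.2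
        = corrV a b c α R p.2 η.1 (verOf Γ p η) ξ.1 (verOf Γ p ξ) := by
      have hR' : R η.1 p.2 ξ.1 = R ξ.1 p.2 η.1 - R ξ.1 η.1 p.2 := by
        rw [← hB ξ.1 p.2 η.1]; abel
      unfold corrV
      rw [show R η.1 ξ.1 p.2 = - R ξ.1 η.1 p.2 from curvatureOf_antisymm _ _ _ _ _, hR']
      match_scalars <;> field_simp <;> rw [hα] <;> ring
    have e3 : fderiv ℝ (fun p => verOf Γ p η) p ξ + Γ p.1 ξ.1 (verOf Γ p η)
        = fderiv ℝ (fun p => verOf Γ p ξ) p η + Γ p.1 η.1 (verOf Γ p ξ) + R ξ.1 η.1 p.2 := by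
      rw [(fderiv_verOf hΓ η ξ).2, (fderiv_verOf hΓ ξ η).2]
      simp only [verOf_apply, hR, curvatureOf_apply, map_add, hc.symm _ hp ξ.1 η.2,
        hc.symm _ hp η.1 ξ.2, hc.symm _ hp p.2, hc.fderiv_symm hp _ p.2]
      abel
    rw [e1, e3, hc.symm _ hp ξ.1 η.1, ← e2]
    congr 1
    abel
  · rw [fderiv_gNaturalOf h ha (hα ▸ hα₀) hp]
    simp only [gNaturalOf_apply, ← hΓdef, verOf_liftOf]
    simp only [liftOf, h.fderiv_apply hp, ← hΓdef, map_add, add_apply]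
    have v1 := lower_corr_vert hα hα₀ (hB ζ.1 p.2 ξ.1) (verOf Γ p ζ) (verOf Γ p ξ)
    have v2 := lower_corr_vert hα hα₀ (hB ζ.1 p.2 η.1) (verOf Γ p ζ) (verOf Γ p η)
    have h1 := lower_corr_hor hα hα₀ (hB ζ.1 p.2 ξ.1) (verOf Γ p ζ) (verOf Γ p ξ)
    have h2 := lower_corr_hor hα hα₀ (hB ζ.1 p.2 η.1) (verOf Γ p ζ) (verOf Γ p η)
    generalize corrH a b α R p.2 ζ.1 (verOf Γ p ζ) ξ.1 (verOf Γ p ξ) = P₁ at *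
    generalize corrH a b α R p.2 ζ.1 (verOf Γ p ζ) η.1 (verOf Γ p η) = P₂ at *
    generalize corrV a b c α R p.2 ζ.1 (verOf Γ p ζ) ξ.1 (verOf Γ p ξ) = Q₁ at *
    generalize corrV a b c α R p.2 ζ.1 (verOf Γ p ζ) η.1 (verOf Γ p η) = Q₂ at *
    generalize verOf Γ p ζ = z at *
    generalize verOf Γ p ξ = v at *
    generalize verOf Γ p η = w at *
    have v1' := congrArg (fun A => γ p.1 A w) v1
    have h1' := congrArg (fun A => γ p.1 A η.1) h1
    have v2' := congrArg (γ p.1 v) v2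
    have h2' := congrArg (γ p.1 ξ.1) h2
    simp only [map_add, map_sub, map_neg, map_smul, add_apply, sub_apply, neg_apply, smul_apply,
      smul_eq_mul] at v1' v2' h1' h2'
    have s (x y v w : E) : γ p.1 (R x y v) w = - γ p.1 v (R x y w) := h.curvatureOf_skew hp x y v w
    have q (x y v w : E) : γ p.1 (R x y v) w = γ p.1 (R v w x) y :=
      h.curvatureOf_pair_symm hp x y v w
    have s1 := s ζ.1 p.2 ξ.1 η.1
    have s2 := s z p.2 ξ.1 η.1
    have s3 : γ p.1 (R v p.2 ζ.1) η.1 = - γ p.1 v (R ζ.1 η.1 p.2) := by rw [q, s]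
    have s4 : γ p.1 ξ.1 (R w p.2 ζ.1) = - γ p.1 (R ζ.1 ξ.1 p.2) w := by
      rw [h.symm _ hp ξ.1, q, s, h.symm _ hp w]
    linear_combination -v1' - v2' - h1' - h2' + b * s1 + (a / 2) * (s2 + s3 + s4)

end FlatGNatural

theorem fderiv_curvature_eq {E : Type*} [NormedAddCommGroup E] [NormedSpace ℝ E]
    (Γ : E → E →L[ℝ] E →L[ℝ] E) (u w x y z : E) :
    fderiv ℝ (curvatureOf Γ) u w x y z = nablaCurvatureOf Γ u w x y z
      - Γ u w (curvatureOf Γ u x y z) + curvatureOf Γ u (Γ u w x) y z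
      + curvatureOf Γ u x (Γ u w y) z + curvatureOf Γ u x y (Γ u w z) := by
  unfold nablaCurvatureOf
  abel

section FlatCurvature

variable {E : Type*} [NormedAddCommGroup E] [NormedSpace ℝ E] [FiniteDimensional ℝ E]
  {γ : E → E →L[ℝ] E →L[ℝ] ℝ} {O : Set E} {a b c α : ℝ}

/-- Covariant derivatives of vector fields given by their horizontal and vertical components. -/
theorem nablaOf_liftOf (h : IsMetricOn γ O) (ha : a ≠ 0)
    (hα : α = a * (a + c) - b ^ 2) (hα₀ : α ≠ 0) {p : E × E} (hp : p.1 ∈ O) (ζ : E × E → E × E)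
    {A B : E × E → E} (hA : DifferentiableAt ℝ A p) (hB : DifferentiableAt ℝ B p) :
    nablaOf (christoffelOf (gNaturalOf γ a b c)) ζ
        (fun p => liftOf (christoffelOf γ) p (A p) (B p)) p
      = liftOf (christoffelOf γ) p
          (fderiv ℝ A p (ζ p) + christoffelOf γ p.1 (ζ p).1 (A p)
            + corrH a b α (curvatureOf (christoffelOf γ) p.1) p.2 (ζ p).1
              (verOf (christoffelOf γ) p (ζ p)) (A p) (B p))
          (fderiv ℝ B p (ζ p) + christoffelOf γ p.1 (ζ p).1 (B p)
            + corrV a b c α (curvatureOf (christoffelOf γ) p.1) p.2 (ζ p).1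
              (verOf (christoffelOf γ) p (ζ p)) (A p) (B p)) := by
  have := FiniteDimensional.complete ℝ E
  have hΓ := h.isConnectionOn.differentiableAt hp
  have hΓ' : DifferentiableAt ℝ (fun p : E × E => christoffelOf γ p.1) p :=
    hΓ.comp p differentiableAt_fst
  have hΓA : DifferentiableAt ℝ (fun p : E × E => christoffelOf γ p.1 p.2 (A p)) p :=
    (hΓ'.clm_apply differentiableAt_snd).clm_apply hA
  have e : fderiv ℝ (fun p => liftOf (christoffelOf γ) p (A p) (B p)) p (ζ p)
      = (fderiv ℝ A p (ζ p), fderiv ℝ B p (ζ p)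
          - (fderiv ℝ (christoffelOf γ) p.1 (ζ p).1 p.2 (A p)
            + christoffelOf γ p.1 (ζ p).2 (A p)
            + christoffelOf γ p.1 p.2 (fderiv ℝ A p (ζ p)))) := by
    unfold liftOf
    rw [DifferentiableAt.fderiv_prodMk hA (hB.fun_sub hΓA), fderiv_fun_sub hB hΓA,
      ContinuousLinearMap.prod_apply, sub_apply,
      fderiv_apply_two hΓ' differentiableAt_snd hA, fderiv_comp_fst hΓ, fderiv_snd_apply]
  rw [nablaOf, christoffelOf_gNaturalOf h ha hα hα₀ hp, e, (fderiv_verOf hΓ _ _).2, verOf_liftOf]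
  simp only [liftOf, map_add]
  refine Prod.ext ?_ ?_
  · simp only [Prod.mk_add_mk]
    abel
  · simp only [Prod.mk_add_mk]
    abel

theorem contDiffOn_liftOf (h : IsMetricOn γ O) {A B : E × E → E}
    (hA : ContDiffOn ℝ ∞ A (O ×ˢ Set.univ)) (hB : ContDiffOn ℝ ∞ B (O ×ˢ Set.univ)) :
    ContDiffOn ℝ ∞ (fun p => liftOf (christoffelOf γ) p (A p) (B p)) (O ×ˢ Set.univ) := by
  have := FiniteDimensional.complete ℝ E
  have h2 : ContDiffOn ℝ ∞ (fun p : E × E => christoffelOf γ p.1) (O ×ˢ Set.univ) :=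
    h.contDiffOn_christoffelOf.comp contDiffOn_fst fun p hp => hp.1
  exact hA.prodMk (hB.sub ((h2.clm_apply contDiffOn_snd).clm_apply hA))

theorem nablaOf_nablaOf_liftOf (h : IsMetricOn γ O) (ha : a ≠ 0)
    (hα : α = a * (a + c) - b ^ 2) (hα₀ : α ≠ 0) {u t : E} (hu : u ∈ O) (x y z : E) :
    let Γ := christoffelOf γ
    let R := curvatureOf Γ u
    let D := nablaCurvatureOf Γ u
    let A := corrH a b α R t y 0 z 0
    let B := corrV a b c α R t y 0 z 0
    nablaOf (christoffelOf (gNaturalOf γ a b c)) (fun p => liftOf Γ p x 0)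
        (nablaOf (christoffelOf (gNaturalOf γ a b c)) (fun p => liftOf Γ p y 0)
          (fun p => liftOf Γ p z 0)) (u, t)
      = liftOf Γ (u, t)
          (fderiv ℝ Γ u x y z + Γ u x (Γ u y z)
            - (a * b / (2 * α)) • (D x y t z + D x z t y)
            + corrH a b α R t (Γ u x y) 0 z 0 + corrH a b α R t y 0 (Γ u x z) 0
            + corrH a b α R t x 0 (Γ u y z) 0 + corrH a b α R t x 0 A B)
          ((b ^ 2 / α) • D x y t z - (a * (a + c) / (2 * α)) • D x y z t
            + corrV a b c α R t (Γ u x y) 0 z 0 + corrV a b c α R t y 0 (Γ u x z) 0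
            + corrV a b c α R t x 0 (Γ u y z) 0 + corrV a b c α R t x 0 A B) := by
  intro Γ R D A B
  have := FiniteDimensional.complete ℝ E
  have hc := h.isConnectionOn
  set S := curvatureOf Γ with hS
  have hOpen : IsOpen (O ×ˢ (Set.univ : Set E)) := h.isOpen.prod isOpen_univ
  have e1 : Set.EqOn (nablaOf (christoffelOf (gNaturalOf γ a b c)) (fun p => liftOf Γ p y 0)
      (fun p => liftOf Γ p z 0))
      (fun p => liftOf Γ p (Γ p.1 y z + corrH a b α (S p.1) p.2 y 0 z 0)
        (corrV a b c α (S p.1) p.2 y 0 z 0)) (O ×ˢ Set.univ) := by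
    intro p hp
    rw [nablaOf_liftOf h ha hα hα₀ hp.1 _ (differentiableAt_const z) (differentiableAt_const 0),
      verOf_liftOf]
    simp [liftOf, Γ, hS]
  have hd : DifferentiableAt ℝ (fun p : E × E => S p.1) (u, t) :=
    DifferentiableAt.comp (g := S) (u, t) (hc.differentiableAt_curvatureOf hu) differentiableAt_fst
  have hd' : DifferentiableAt ℝ (fun p : E × E => Γ p.1) (u, t) :=
    DifferentiableAt.comp (g := Γ) (u, t) (hc.differentiableAt hu) differentiableAt_fst
  have k (v : E) : DifferentiableAt ℝ (fun _ : E × E => v) (u, t) := differentiableAt_const v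
  have dR {X Y Z : E × E → E} (hX : DifferentiableAt ℝ X (u, t))
      (hY : DifferentiableAt ℝ Y (u, t)) (hZ : DifferentiableAt ℝ Z (u, t)) :
      DifferentiableAt ℝ (fun p : E × E => S p.1 (X p) (Y p) (Z p)) (u, t) :=
    ((hd.clm_apply hX).clm_apply hY).clm_apply hZ
  have dsnd : DifferentiableAt ℝ (fun p : E × E => p.2) (u, t) := differentiableAt_snd
  have dΓ : DifferentiableAt ℝ (fun p : E × E => Γ p.1 y z) (u, t) :=
    (hd'.clm_apply (k y)).clm_apply (k z)
  have eH (p : E × E) : corrH a b α (S p.1) p.2 y 0 z 0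
      = (-(a * b / (2 * α))) • (S p.1 y p.2 z + S p.1 z p.2 y) := by
    simp [corrH, add_comm]
  have eV (p : E × E) : corrV a b c α (S p.1) p.2 y 0 z 0
      = (b ^ 2 / α) • S p.1 y p.2 z - (a * (a + c) / (2 * α)) • S p.1 y z p.2 := by
    simp [corrV]
  have dH : DifferentiableAt ℝ (fun p : E × E => corrH a b α (S p.1) p.2 y 0 z 0) (u, t) := by
    simp only [eH]
    exact ((dR (k y) dsnd (k z)).fun_add (dR (k z) dsnd (k y))).fun_const_smul _
  have dV : DifferentiableAt ℝ (fun p : E × E => corrV a b c α (S p.1) p.2 y 0 z 0) (u, t) := by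
    simp only [eV]
    exact ((dR (k y) dsnd (k z)).fun_const_smul _).fun_sub
      ((dR (k y) (k z) dsnd).fun_const_smul _)
  have fR (y z : E) : fderiv ℝ (fun p : E × E => S p.1 y p.2 z) (u, t) (liftOf Γ (u, t) x 0)
      = D x y t z - Γ u x (R y t z) + R (Γ u x y) t z + R y t (Γ u x z) := by
    rw [fderiv_apply_three hd (k y) dsnd (k z), fderiv_comp_fst (hc.differentiableAt_curvatureOf hu),
      fderiv_snd_apply, hS, fderiv_curvature_eq]
    simp [liftOf, hc.symm u hu t x, R, D, Γ]
    abel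
  have fR' : fderiv ℝ (fun p : E × E => S p.1 y z p.2) (u, t) (liftOf Γ (u, t) x 0)
      = D x y z t - Γ u x (R y z t) + R (Γ u x y) z t + R y (Γ u x z) t := by
    rw [fderiv_apply_three hd (k y) (k z) dsnd, fderiv_comp_fst (hc.differentiableAt_curvatureOf hu),
      fderiv_snd_apply, hS, fderiv_curvature_eq]
    simp [liftOf, hc.symm u hu t x, R, D, Γ]
  have fH : fderiv ℝ (fun p : E × E => Γ p.1 y z + corrH a b α (S p.1) p.2 y 0 z 0) (u, t)
      (liftOf Γ (u, t) x 0) = fderiv ℝ Γ u x y z + (-(a * b / (2 * α))) •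
        ((D x y t z - Γ u x (R y t z) + R (Γ u x y) t z + R y t (Γ u x z))
          + (D x z t y - Γ u x (R z t y) + R (Γ u x z) t y + R z t (Γ u x y))) := by
    rw [fderiv_fun_add dΓ dH, add_apply, fderiv_apply_two hd' (k y) (k z),
      fderiv_comp_fst (hc.differentiableAt hu)]
    simp only [eH]
    rw [fderiv_fun_const_smul ((dR (k y) dsnd (k z)).fun_add (dR (k z) dsnd (k y))), smul_apply,
      fderiv_fun_add (dR (k y) dsnd (k z)) (dR (k z) dsnd (k y)), add_apply, fR, fR]
    simp [liftOf, Γ]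
  have fV : fderiv ℝ (fun p : E × E => corrV a b c α (S p.1) p.2 y 0 z 0) (u, t)
      (liftOf Γ (u, t) x 0)
      = (b ^ 2 / α) • (D x y t z - Γ u x (R y t z) + R (Γ u x y) t z + R y t (Γ u x z))
        - (a * (a + c) / (2 * α)) •
          (D x y z t - Γ u x (R y z t) + R (Γ u x y) z t + R y (Γ u x z) t) := by
    simp only [eV]
    rw [fderiv_fun_sub ((dR (k y) dsnd (k z)).fun_const_smul _)
      ((dR (k y) (k z) dsnd).fun_const_smul _), sub_apply,
      fderiv_fun_const_smul (dR (k y) dsnd (k z)), fderiv_fun_const_smul (dR (k y) (k z) dsnd),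
      smul_apply, smul_apply, fR, fR']
  rw [nablaOf, fderiv_eq_of_eqOn hOpen e1 ⟨hu, trivial⟩, e1 ⟨hu, trivial⟩]
  have := nablaOf_liftOf h ha hα hα₀ (p := (u, t)) hu (fun p => liftOf Γ p x 0)
    (dΓ.fun_add dH) dV
  rw [nablaOf] at this
  rw [this, verOf_liftOf, fH, fV]
  have g1 : (liftOf Γ (u, t) x 0).1 = x := rfl
  simp only [g1]
  congr 1
  · simp only [A, B, corrH, corrV, map_add, map_sub, map_neg, map_smul, map_zero, add_apply,
      sub_apply, neg_apply, smul_apply, zero_apply, add_zero, smul_zero, sub_zero, ← hS, R, Γ]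
    module
  · simp only [A, B, corrH, corrV, map_add, map_sub, map_neg, map_smul, map_zero, add_apply,
      sub_apply, neg_apply, smul_apply, zero_apply, add_zero, smul_zero, sub_zero, ← hS, R, Γ]
    module

theorem nablaOf_congr_at {F : Type*} [NormedAddCommGroup F] [NormedSpace ℝ F]
    (Γ : F → F →L[ℝ] F →L[ℝ] F) {X X' : F → F} (Y : F → F) {u : F} (h : X u = X' u) :
    nablaOf Γ X Y u = nablaOf Γ X' Y u := by
  rw [nablaOf, nablaOf, h]

/-- The curvature of the `g`-natural metric on horizontal vectors, before simplification. -/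
theorem curvatureOf_gNaturalOf_aux (h : IsMetricOn γ O) (ha : a ≠ 0)
    (hα : α = a * (a + c) - b ^ 2) (hα₀ : α ≠ 0) {u t : E} (hu : u ∈ O) (x y z : E) :
    let Γ := christoffelOf γ
    let R := curvatureOf Γ u
    let D := nablaCurvatureOf Γ u
    curvatureOf (christoffelOf (gNaturalOf γ a b c)) (u, t) (liftOf Γ (u, t) x 0)
        (liftOf Γ (u, t) y 0) (liftOf Γ (u, t) z 0)
      = liftOf Γ (u, t)
          (R x y z - (a * b / (2 * α)) • (D x y t z + D x z t y - D y x t z - D y z t x)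
            + corrH a b α R t x 0 (corrH a b α R t y 0 z 0) (corrV a b c α R t y 0 z 0)
            - corrH a b α R t y 0 (corrH a b α R t x 0 z 0) (corrV a b c α R t x 0 z 0)
            + corrH a b α R t 0 (R x y t) z 0)
          ((b ^ 2 / α) • (D x y t z - D y x t z)
            - (a * (a + c) / (2 * α)) • (D x y z t - D y x z t)
            + corrV a b c α R t x 0 (corrH a b α R t y 0 z 0) (corrV a b c α R t y 0 z 0)
            - corrV a b c α R t y 0 (corrH a b α R t x 0 z 0) (corrV a b c α R t x 0 z 0)
            + corrV a b c α R t 0 (R x y t) z 0) := by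
  intro Γ R D
  have := FiniteDimensional.complete ℝ E
  have hc := h.isConnectionOn
  have hG := isMetricOn_gNaturalOf h ha (hα ▸ hα₀)
  have hp : (u, t) ∈ O ×ˢ (Set.univ : Set E) := ⟨hu, trivial⟩
  have hs (v : E) : ContDiffOn ℝ ∞ (fun p => liftOf Γ p v 0) (O ×ˢ Set.univ) :=
    contDiffOn_liftOf h contDiffOn_const contDiffOn_const
  have e := hG.isConnectionOn.nablaOf_curvature hp (hs x) (hs y) (hs z)
  have b1 (x y : E) : nablaOf (christoffelOf (gNaturalOf γ a b c)) (fun p => liftOf Γ p x 0)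
      (fun p => liftOf Γ p y 0) (u, t)
      = liftOf Γ (u, t) (Γ u x y + corrH a b α R t x 0 y 0) (corrV a b c α R t x 0 y 0) := by
    rw [nablaOf_liftOf h ha hα hα₀ hu _ (differentiableAt_const y) (differentiableAt_const 0),
      verOf_liftOf]
    simp [liftOf, Γ, R]
  have hB (x t v : E) : R x t v - R v t x = R x v t := by
    have := hc.bianchi_first hu x t v
    rw [curvatureOf_antisymm _ _ t v, curvatureOf_antisymm _ _ v x] at this
    linear_combination (norm := module) this
  have b2 : (nablaOf (christoffelOf (gNaturalOf γ a b c)) (fun p => liftOf Γ p x 0)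
      (fun p => liftOf Γ p y 0) - nablaOf (christoffelOf (gNaturalOf γ a b c))
      (fun p => liftOf Γ p y 0) (fun p => liftOf Γ p x 0)) (u, t)
      = (fun p => liftOf Γ p 0 (-R x y t)) (u, t) := by
    rw [Pi.sub_apply, b1, b1]
    have hsy : Γ u x y = Γ u y x := hc.symm u hu x y
    have e1 : corrH a b α R t x 0 y 0 = corrH a b α R t y 0 x 0 := by
      unfold corrH
      module
    have e2 : corrV a b c α R t x 0 y 0 = corrV a b c α R t y 0 x 0 - R x y t := by
      have hR' : R y t x = R x t y - R x y t := by rw [← hB x t y]; abel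
      unfold corrV
      rw [show R y x t = - R x y t from curvatureOf_antisymm _ _ _ _ _, hR']
      simp only [map_zero, zero_apply, add_zero, smul_zero]
      match_scalars
      · ring
      · field_simp
        rw [hα]
        ring
    rw [hsy, e1, e2]
    simp only [liftOf, Prod.mk_sub_mk, sub_self, map_zero, sub_zero]
    refine Prod.ext rfl ?_
    simp only
    abel
  rw [nablaOf_congr_at (X' := fun p => liftOf Γ p 0 (-R x y t)) _ (fun p => liftOf Γ p z 0) b2,
    nablaOf_nablaOf_liftOf h ha hα hα₀ hu,
    nablaOf_nablaOf_liftOf h ha hα hα₀ hu,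
    nablaOf_liftOf h ha hα hα₀ hu _ (differentiableAt_const z) (differentiableAt_const 0),
    verOf_liftOf] at e
  rw [← e]
  have g1 (v w : E) : (liftOf Γ (u, t) v w).1 = v := rfl
  have hl (A B A' B' : E) : liftOf Γ (u, t) A B - liftOf Γ (u, t) A' B'
      = liftOf Γ (u, t) (A - A') (B - B') := by
    refine Prod.ext rfl ?_
    simp only [liftOf, Prod.snd_sub, map_sub]
    abel
  have hsy : Γ u x y = Γ u y x := hc.symm u hu x y
  have hRdef : R x y z = fderiv ℝ Γ u x y z - fderiv ℝ Γ u y x z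
      + (Γ u x (Γ u y z) - Γ u y (Γ u x z)) := curvatureOf_apply _ _ _ _ _
  have hneg1 : corrH a b α R t 0 (-R x y t) z 0 = - corrH a b α R t 0 (R x y t) z 0 := by
    simp [corrH]
  have hneg2 : corrV a b c α R t 0 (-R x y t) z 0 = - corrV a b c α R t 0 (R x y t) z 0 := by
    simp [corrV]
  simp only [g1, hl, ← show Γ = christoffelOf γ from rfl, hRdef,
    ← show R = curvatureOf Γ u from rfl, hneg1, hneg2, fderiv_fun_const, Pi.zero_apply,
    zero_apply, map_zero, hsy]
  simp only [← show D = nablaCurvatureOf Γ u from rfl]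
  congr 1
  · module
  · module

/-- The curvature of the `g`-natural metric on horizontal vectors. -/
theorem curvatureOf_gNaturalOf (h : IsMetricOn γ O) (ha : a ≠ 0)
    (hα : α = a * (a + c) - b ^ 2) (hα₀ : α ≠ 0) {u t : E} (hu : u ∈ O) (x y z : E) :
    let Γ := christoffelOf γ
    let R := fun x y z => curvatureOf Γ u x y z
    let D := nablaCurvatureOf Γ u
    curvatureOf (christoffelOf (gNaturalOf γ a b c)) (u, t) (liftOf Γ (u, t) x 0)
        (liftOf Γ (u, t) y 0) (liftOf Γ (u, t) z 0)
      = liftOf Γ (u, t)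
          (R x y z
            + (a * b / (2 * α)) • ((2 : ℝ) • D t x y z - D z x y t)
            + (a ^ 2 / (4 * α)) • (R (R y z t) t x - R (R x z t) t y)
            + (a ^ 2 * b ^ 2 / (4 * α ^ 2)) •
                (R x t (R y t z) + R x t (R z t y) - R y t (R x t z) - R y t (R z t x))
            - (a ^ 2 / (2 * α)) • R (R x y t) t z)
          (- ((b ^ 2 / α) • D t x y z)
            + (a * (a + c) / (2 * α)) • D z x y t
            + (a * b ^ 3 / (2 * α ^ 2)) •
                (R (R y t z) x t - R x t (R z t y) - R (R x t z) y t + R y t (R z t x))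
            + (a ^ 2 * b * (a + c) / (4 * α ^ 2)) •
                (R x (R y t z) t + R x (R z t y) t - R y (R x t z) t - R y (R z t x) t
                  - R (R y z t) t x + R (R x z t) t y)
            + (a * b / (2 * α)) • R (R x y t) t z) := by
  intro Γ R D
  have := FiniteDimensional.complete ℝ E
  have hc := h.isConnectionOn
  rw [curvatureOf_gNaturalOf_aux h ha hα hα₀ hu]
  have hB (x t v : E) : R v t x = R x t v - R x v t := by
    have := hc.bianchi_first hu x t v
    rw [curvatureOf_antisymm _ _ t v, curvatureOf_antisymm _ _ v x] at this
    linear_combination (norm := module) -this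
  have i1 (x y : E) : R (R y t z) t x = R (R z t y) t x + R (R y z t) t x := by
    rw [hB y t z]
    simp [R]
  have i2 (x y : E) : R (R y t z) t x = R x t (R y t z) + R (R y t z) x t := by
    rw [hB x t (R y t z), show R (R y t z) x t = - R x (R y t z) t from
      curvatureOf_antisymm _ _ _ _ _]
    abel
  have d1 : D x y t z = D y x t z - D t x y z := by
    have := hc.bianchi_second hu x y t z
    have h2 := hc.nablaCurvatureOf_antisymm hu y t x z
    linear_combination (norm := module) this - h2
  have d2 : D x z t y = D y z t x + (D z x y t - D t x y z) := by
    have := h.nablaCurvatureOf_sub hu x y z t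
    linear_combination (norm := module) this
  have d3 : D x y z t = D y x z t - D z x y t := by
    have := hc.bianchi_second hu x y z t
    have h2 := hc.nablaCurvatureOf_antisymm hu y z x t
    linear_combination (norm := module) this - h2
  dsimp only [R, D, Γ] at i1 i2 d1 d2 d3 ⊢
  rw [d1, d2, d3]
  congr 1
  · simp only [corrH, corrV, map_add, map_sub, map_neg, map_smul, map_zero, add_apply,
      sub_apply, neg_apply, smul_apply, zero_apply, add_zero, smul_zero, sub_zero, zero_add]
    rw [i1 x y, i1 y x]
    match_scalars <;> field_simp <;> (try rw [hα]) <;> ring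
  · simp only [corrH, corrV, map_add, map_sub, map_neg, map_smul, map_zero, add_apply,
      sub_apply, neg_apply, smul_apply, zero_apply, add_zero, smul_zero, sub_zero, zero_add]
    rw [i2 x y, i2 y x]
    match_scalars <;> field_simp <;> ring

end FlatCurvature

section Overlap

variable {F : Type*} [NormedAddCommGroup F] [NormedSpace ℝ F]
  {H : Type*} [TopologicalSpace H] {I : ModelWithCorners ℝ F H}
  {N : Type*} [TopologicalSpace N] [ChartedSpace H N]

/-- The set on which the change of charts from `p` to `q` is defined. -/
def overlap (I : ModelWithCorners ℝ F H) (p q : N) : Set F :=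
  ((extChartAt I p).symm ≫ extChartAt I q).source

theorem mem_overlap {p q : N} {u : F} : u ∈ overlap I p q ↔
    u ∈ (extChartAt I p).target ∧ (extChartAt I p).symm u ∈ (extChartAt I q).source := by
  simp only [overlap, PartialEquiv.trans_source, PartialEquiv.symm_source, Set.mem_inter_iff,
    Set.mem_preimage]

theorem isOpen_overlap [I.Boundaryless] (p q : N) : IsOpen (overlap I p q) := by
  have h : overlap I p q
      = (extChartAt I p).target ∩ (extChartAt I p).symm ⁻¹' (extChartAt I q).source := by
    ext u
    exact mem_overlap
  rw [h]
  exact (continuousOn_extChartAt_symm p).isOpen_inter_preimage (isOpen_extChartAt_target p)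
    (isOpen_extChartAt_source q)

end Overlap

section Charts

variable {F : Type*} [NormedAddCommGroup F] [NormedSpace ℝ F]
  {H : Type*} [TopologicalSpace H] {I : ModelWithCorners ℝ F H}
  {N : Type*} [TopologicalSpace N] [ChartedSpace H N] [IsManifold I ∞ N]

theorem coordField_extChartAt (Y : ∀ q : N, TangentSpace I q) {p r : N}
    (hr : r ∈ (extChartAt I p).source) :
    coordField Y p (extChartAt I p r) = tangentCoordChange I r p r (Y r) := by
  have h1 : (extChartAt I p).symm (extChartAt I p r) = r := (extChartAt I p).left_inv hr
  have h2 : coordField Y p (extChartAt I p r)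
      = (trivializationAt F (TangentSpace I) p).continuousLinearMapAt ℝ r (Y r) :=
    congrArg (fun q => (trivializationAt F (TangentSpace I) p).continuousLinearMapAt ℝ q (Y q)) h1
  rw [h2]
  exact congrArg (fun L : F →L[ℝ] F => L (Y r))
    (TangentBundle.continuousLinearMapAt_trivializationAt_eq_core (by rwa [extChartAt_source] at hr))

theorem coordField_self (Y : ∀ q : N, TangentSpace I q) (p : N) :
    coordField Y p (extChartAt I p p) = Y p := by
  rw [coordField_extChartAt Y (mem_extChartAt_source p)]
  exact tangentCoordChange_self (mem_extChartAt_source p)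

theorem coordField_sub (X Y : ∀ q : N, TangentSpace I q) (p : N) :
    coordField (X - Y) p = coordField X p - coordField Y p := by
  funext u
  exact map_sub _ _ _

theorem coordMetric_extChartAt
    (h : ∀ q : N, TangentSpace I q →L[ℝ] TangentSpace I q →L[ℝ] ℝ) {p r : N}
    (hr : r ∈ (extChartAt I p).source) (v w : F) :
    coordMetric h p (extChartAt I p r) v w
      = (h r : F →L[ℝ] F →L[ℝ] ℝ) (tangentCoordChange I p r r v) (tangentCoordChange I p r r w) := by
  have h1 : (extChartAt I p).symm (extChartAt I p r) = r := (extChartAt I p).left_inv hr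
  have h2 : coordMetric h p (extChartAt I p r) v w
      = h r ((trivializationAt F (TangentSpace I) p).symmL ℝ r v)
        ((trivializationAt F (TangentSpace I) p).symmL ℝ r w) :=
    congrArg (fun q => h q ((trivializationAt F (TangentSpace I) p).symmL ℝ q v)
        ((trivializationAt F (TangentSpace I) p).symmL ℝ q w)) h1
  rw [h2]
  have h3 : ((trivializationAt F (TangentSpace I) p).symmL ℝ r : F →L[ℝ] F)
      = tangentCoordChange I p r r :=
    TangentBundle.symmL_trivializationAt_eq_core (by rwa [extChartAt_source] at hr)
  exact congrArg (fun L : F →L[ℝ] F => (h r : F →L[ℝ] F →L[ℝ] ℝ) (L v) (L w)) h3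

theorem contDiffOn_chartChange (p q : N) :
    ContDiffOn ℝ ∞ (extChartAt I q ∘ (extChartAt I p).symm) (overlap I p q) :=
  contDiffOn_ext_coord_change q p

variable [I.Boundaryless]

theorem tangentCoordChange_eq_fderiv (p q r : N) :
    tangentCoordChange I p q r
      = fderiv ℝ (extChartAt I q ∘ (extChartAt I p).symm) (extChartAt I p r) := by
  rw [tangentCoordChange_def, I.range_eq_univ, fderivWithin_univ]

theorem coordField_chartChange (Y : ∀ q : N, TangentSpace I q) {p q : N} {u : F}
    (hu : u ∈ overlap I p q) :
    coordField Y q (extChartAt I q ((extChartAt I p).symm u))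
      = fderiv ℝ (extChartAt I q ∘ (extChartAt I p).symm) u (coordField Y p u) := by
  obtain ⟨h1, h2⟩ := mem_overlap.1 hu
  set r := (extChartAt I p).symm u with hr
  have hu' : extChartAt I p r = u := (extChartAt I p).right_inv h1
  have h3 : r ∈ (extChartAt I p).source := (extChartAt I p).map_target h1
  rw [← hu', ← tangentCoordChange_eq_fderiv, coordField_extChartAt Y h2,
    coordField_extChartAt Y h3]
  exact (tangentCoordChange_comp ⟨⟨mem_extChartAt_source r, h3⟩, h2⟩).symm

theorem coordMetric_chartChange
    (h : ∀ q : N, TangentSpace I q →L[ℝ] TangentSpace I q →L[ℝ] ℝ) {p q : N} {u : F}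
    (hu : u ∈ overlap I p q) (v w : F) :
    coordMetric h p u v w = coordMetric h q (extChartAt I q ((extChartAt I p).symm u))
      (fderiv ℝ (extChartAt I q ∘ (extChartAt I p).symm) u v)
      (fderiv ℝ (extChartAt I q ∘ (extChartAt I p).symm) u w) := by
  obtain ⟨h1, h2⟩ := mem_overlap.1 hu
  set r := (extChartAt I p).symm u with hr
  have hu' : extChartAt I p r = u := (extChartAt I p).right_inv h1
  have h3 : r ∈ (extChartAt I p).source := (extChartAt I p).map_target h1
  rw [← hu', ← tangentCoordChange_eq_fderiv, coordMetric_extChartAt h h2,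
    coordMetric_extChartAt h h3, tangentCoordChange_comp ⟨⟨h3, h2⟩, mem_extChartAt_source r⟩,
    tangentCoordChange_comp ⟨⟨h3, h2⟩, mem_extChartAt_source r⟩]

/-- `h` is a smooth metric (nondegenerate, symmetric) on `N`. -/
def IsSmoothMetric (h : ∀ q : N, TangentSpace I q →L[ℝ] TangentSpace I q →L[ℝ] ℝ) : Prop :=
  ∀ p : N, IsMetricOn (coordMetric h p) (extChartAt I p).target

/-- The transformation law of the Christoffel symbols between preferred charts. -/
theorem christoffel_chartChange
    {h : ∀ q : N, TangentSpace I q →L[ℝ] TangentSpace I q →L[ℝ] ℝ} (hh : IsSmoothMetric h)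
    {p q : N} {u : F} (hu : u ∈ overlap I p q) (v w : F) :
    fderiv ℝ (extChartAt I q ∘ (extChartAt I p).symm) u (christoffel h p u v w)
      = fderiv ℝ (fderiv ℝ (extChartAt I q ∘ (extChartAt I p).symm)) u v w
        + christoffel h q (extChartAt I q ((extChartAt I p).symm u))
          (fderiv ℝ (extChartAt I q ∘ (extChartAt I p).symm) u v)
          (fderiv ℝ (extChartAt I q ∘ (extChartAt I p).symm) u w) := by
  obtain ⟨h1, h2⟩ := mem_overlap.1 hu
  have hopen := isOpen_overlap (I := I) p q
  refine christoffelOf_transform (hh p) (hh q) h1 ((extChartAt I q).map_source h2)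
    ((contDiffOn_chartChange p q).contDiffAt (hopen.mem_nhds hu)) ?_ ?_ v w
  · set r := (extChartAt I p).symm u with hr
    have hu' : extChartAt I p r = u := (extChartAt I p).right_inv h1
    have h3 : r ∈ (extChartAt I p).source := (extChartAt I p).map_target h1
    intro z
    refine ⟨tangentCoordChange I q p r z, ?_⟩
    rw [← hu', ← tangentCoordChange_eq_fderiv, tangentCoordChange_comp ⟨⟨h2, h3⟩, h2⟩,
      tangentCoordChange_self h2]
  · filter_upwards [hopen.mem_nhds hu] with w hw x y
    exact coordMetric_chartChange h hw x y

/-- In any chart, `∇_X Y` is given by the Christoffel symbols of that chart. -/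
theorem coordField_nabla
    {h : ∀ q : N, TangentSpace I q →L[ℝ] TangentSpace I q →L[ℝ] ℝ} (hh : IsSmoothMetric h)
    (X : ∀ q : N, TangentSpace I q) {Y : ∀ q : N, TangentSpace I q} {p : N} {u : F}
    (hu : u ∈ (extChartAt I p).target) (hY : DifferentiableAt ℝ (coordField Y p) u) :
    coordField (nabla h X Y) p u
      = nablaOf (christoffel h p) (coordField X p) (coordField Y p) u := by
  set q := (extChartAt I p).symm u with hq
  have hqp : q ∈ (extChartAt I p).source := (extChartAt I p).map_target hu
  have hqq : q ∈ (extChartAt I q).source := mem_extChartAt_source q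
  have hpq : extChartAt I p q = u := (extChartAt I p).right_inv hu
  set φ := extChartAt I q ∘ (extChartAt I p).symm with hφ
  set ψ := extChartAt I p ∘ (extChartAt I q).symm with hψ
  set w := extChartAt I q q with hw
  have huo : u ∈ overlap I p q := mem_overlap.2 ⟨hu, hqq⟩
  have hwq : (extChartAt I q).symm w = q := (extChartAt I q).left_inv hqq
  have hwo : w ∈ overlap I q p :=
    mem_overlap.2 ⟨mem_extChartAt_target q, by rw [hwq]; exact hqp⟩
  have hψw : ψ w = u := by simp only [hψ, Function.comp_apply, hwq, hpq]
  have hdφ : DifferentiableAt ℝ (fderiv ℝ φ) u :=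
    differentiableAt_of_contDiffOn (isOpen_overlap p q)
      (contDiffOn_fderiv (isOpen_overlap p q) (contDiffOn_chartChange p q)) huo
  have hdψ : DifferentiableAt ℝ ψ w :=
    differentiableAt_of_contDiffOn (isOpen_overlap q p) (contDiffOn_chartChange q p) hwo
  have hback (V : ∀ q : N, TangentSpace I q) : fderiv ℝ ψ w (V q) = coordField V p u := by
    have e := coordField_chartChange V hwo
    rw [hwq, hpq, coordField_self] at e
    exact e.symm
  have hforth (V : ∀ q : N, TangentSpace I q) : (V q : F) = fderiv ℝ φ u (coordField V p u) := by
    have e := coordField_chartChange V huo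
    rw [← hq, coordField_self] at e
    exact e
  have hinv (z : F) : fderiv ℝ ψ w (fderiv ℝ φ u z) = z := by
    have e1 : fderiv ℝ ψ w = tangentCoordChange I q p q := (tangentCoordChange_eq_fderiv q p q).symm
    have e2 : fderiv ℝ φ u = tangentCoordChange I p q q := by
      rw [tangentCoordChange_eq_fderiv, hpq]
    rw [e1, e2, tangentCoordChange_comp ⟨⟨hqp, hqq⟩, hqp⟩, tangentCoordChange_self hqp]
  set S : F → F := fun u => fderiv ℝ φ u (coordField Y p u) with hS
  have hSd : DifferentiableAt ℝ S u := hdφ.clm_apply hY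
  have hev : coordField Y q =ᶠ[𝓝 w] S ∘ ψ := by
    filter_upwards [(isOpen_overlap (I := I) q p).mem_nhds hwo] with v hv
    obtain ⟨hv1, hv2⟩ := mem_overlap.1 hv
    have e1 : (extChartAt I p).symm (ψ v) = (extChartAt I q).symm v := (extChartAt I p).left_inv hv2
    have hvo : ψ v ∈ overlap I p q := mem_overlap.2
      ⟨(extChartAt I p).map_source hv2, by rw [e1]; exact (extChartAt I q).map_target hv1⟩
    have e := coordField_chartChange Y hvo
    rw [e1, (extChartAt I q).right_inv hv1] at e
    exact e
  have hfd_aux (v : F) (hv : fderiv ℝ ψ w v = coordField X p u) : fderiv ℝ (coordField Y q) w v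
      = fderiv ℝ (fderiv ℝ φ) u (coordField X p u)
      (coordField Y p u) + fderiv ℝ φ u (fderiv ℝ (coordField Y p) u (coordField X p u)) := by
    rw [hev.fderiv_eq, fderiv_comp w (by rwa [hψw]) hdψ, hψw, ContinuousLinearMap.comp_apply,
      hv, fderiv_apply_one hdφ hY]
  have hfd := hfd_aux (X q) (hback X)
  have hnab : (nabla h X Y q : F)
      = fderiv ℝ (coordField Y q) w (X q) + christoffel h q w (X q) (Y q) := rfl
  have hΓ := christoffel_chartChange hh huo (coordField X p u) (coordField Y p u)
  rw [← hforth X, ← hforth Y, ← hq] at hΓ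
  rw [← hback, hnab, hfd]
  rw [add_right_comm]
  have : fderiv ℝ (fderiv ℝ φ) u (coordField X p u) (coordField Y p u)
      + christoffel h q w (X q) (Y q) + fderiv ℝ φ u (fderiv ℝ (coordField Y p) u (coordField X p u))
      = fderiv ℝ φ u (nablaOf (christoffel h p) (coordField X p) (coordField Y p) u) := by
    rw [nablaOf, map_add, add_comm]
    exact congrArg _ hΓ.symm
  rw [this, hinv]

theorem mlieBracket_eq_fderiv (X Y : ∀ q : N, TangentSpace I q) (q : N) :
    (mlieBracket I X Y q : F)
      = fderiv ℝ (coordField Y q) (extChartAt I q q) (X q)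
        - fderiv ℝ (coordField X q) (extChartAt I q q) (Y q) := by
  set w := extChartAt I q q with hw
  set P : (∀ q : N, TangentSpace I q) → F → F := fun V u =>
    mpullbackWithin 𝓘(ℝ, F) I (extChartAt I q).symm V (Set.range I) u with hP
  have hev (V : ∀ q : N, TangentSpace I q) : P V =ᶠ[𝓝 w] coordField V q := by
    filter_upwards [extChartAt_target_mem_nhds (I := I) q] with v hv
    have hr : (extChartAt I q).symm v ∈ (chartAt H q).source := by
      rw [← extChartAt_source I]
      exact (extChartAt I q).map_target hv
    have e1 := ContinuousLinearMap.inverse_eq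
      (mfderivWithin_extChartAt_symm_comp_mfderiv_extChartAt hv)
      (mfderiv_extChartAt_comp_mfderivWithin_extChartAt_symm hv)
    rw [hP, coordField, TangentBundle.continuousLinearMapAt_trivializationAt hr]
    simp only [mpullbackWithin_apply]
    rw [e1]
    rfl
  set A : F →L[ℝ] F := mfderiv I 𝓘(ℝ, F) (extChartAt I q) q with hA
  have hA1 : A = ContinuousLinearMap.id ℝ F := mfderiv_extChartAt_self
  have e0 : (mlieBracket I X Y q : F) = A.inverse (lieBracketWithin ℝ (P X) (P Y)
      ((extChartAt I q).symm ⁻¹' Set.univ ∩ Set.range I) w) := rfl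
  have e1 (V : ∀ q : N, TangentSpace I q) : P V w = (V q : F) := by
    rw [(hev V).self_of_nhds, coordField_self]
  rw [e0, hA1, ContinuousLinearMap.inverse_id, I.range_eq_univ, Set.preimage_univ, Set.univ_inter,
    lieBracketWithin_univ, lieBracket, (hev X).fderiv_eq, (hev Y).fderiv_eq, e1, e1]
  rfl

/-- The Levi-Civita connection is torsion-free. -/
theorem mlieBracket_eq_nabla
    {h : ∀ q : N, TangentSpace I q →L[ℝ] TangentSpace I q →L[ℝ] ℝ} (hh : IsSmoothMetric h)
    (X Y : ∀ q : N, TangentSpace I q) : mlieBracket I X Y = nabla h X Y - nabla h Y X := by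
  funext q
  have e1 : (nabla h X Y q : F) = fderiv ℝ (coordField Y q) (extChartAt I q q) (X q)
    + christoffel h q (extChartAt I q q) (X q) (Y q) := rfl
  have e2 : (nabla h Y X q : F) = fderiv ℝ (coordField X q) (extChartAt I q q) (Y q)
    + christoffel h q (extChartAt I q q) (Y q) (X q) := rfl
  have e3 : christoffel h q (extChartAt I q q) (Y q) (X q)
      = christoffel h q (extChartAt I q q) (X q) (Y q) :=
    (hh q).christoffelOf_symm (mem_extChartAt_target q) _ _
  have e4 : (mlieBracket I X Y q : F) = (nabla h X Y q : F) - (nabla h Y X q : F) := by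
    rw [mlieBracket_eq_fderiv, e1, e2, e3]
    abel
  exact e4

end Charts

theorem IsMetricOn.mono {F : Type*} [NormedAddCommGroup F] [NormedSpace ℝ F]
    {γ : F → F →L[ℝ] F →L[ℝ] ℝ} {O O' : Set F} (h : IsMetricOn γ O) (hO' : IsOpen O')
    (hsub : O' ⊆ O) : IsMetricOn γ O' :=
  ⟨hO', h.contDiffOn.mono hsub, fun u hu => h.symm u (hsub hu),
    fun u hu => h.isInvertible u (hsub hu)⟩

section CoordCurvature

variable {F : Type*} [NormedAddCommGroup F] [NormedSpace ℝ F]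
  {H : Type*} [TopologicalSpace H] {I : ModelWithCorners ℝ F H}
  {N : Type*} [TopologicalSpace N] [ChartedSpace H N] [IsManifold I ∞ N]
  {h : ∀ q : N, TangentSpace I q →L[ℝ] TangentSpace I q →L[ℝ] ℝ} {p : N} {O : Set F}
  {W X Y Z : ∀ q : N, TangentSpace I q}

theorem nablaOf_congr {Γ : F → F →L[ℝ] F →L[ℝ] F} {V V' : F → F} (hO : IsOpen O)
    (hV : Set.EqOn V V' O) (U : F → F) {u : F} (hu : u ∈ O) :
    nablaOf Γ U V u = nablaOf Γ U V' u := by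
  rw [nablaOf, nablaOf, fderiv_eq_of_eqOn hO hV hu, hV hu]

theorem isConnectionOn_christoffel [FiniteDimensional ℝ F] (hh : IsSmoothMetric h) (hO : IsOpen O)
    (hsub : O ⊆ (extChartAt I p).target) : IsConnectionOn (christoffel h p) O := by
  have := FiniteDimensional.complete ℝ F
  exact ((hh p).mono hO hsub).isConnectionOn

variable [I.Boundaryless]

theorem eqOn_coordField_nabla (hh : IsSmoothMetric h) (hO : IsOpen O)
    (hsub : O ⊆ (extChartAt I p).target) (X : ∀ q : N, TangentSpace I q)
    (hY : ContDiffOn ℝ ∞ (coordField Y p) O) :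
    Set.EqOn (coordField (nabla h X Y) p)
      (nablaOf (christoffel h p) (coordField X p) (coordField Y p)) O := fun _ hu =>
  coordField_nabla hh X (hsub hu) (differentiableAt_of_contDiffOn hO hY hu)

variable [FiniteDimensional ℝ F]

theorem contDiffOn_coordField_nabla (hh : IsSmoothMetric h) (hO : IsOpen O)
    (hsub : O ⊆ (extChartAt I p).target) (hX : ContDiffOn ℝ ∞ (coordField X p) O)
    (hY : ContDiffOn ℝ ∞ (coordField Y p) O) :
    ContDiffOn ℝ ∞ (coordField (nabla h X Y) p) O :=
  ((isConnectionOn_christoffel hh hO hsub).contDiffOn_nablaOf hX hY).congr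
    (eqOn_coordField_nabla hh hO hsub X hY)

/-- In any chart, the curvature is given by the curvature tensor of that chart. -/
theorem eqOn_coordField_curvature (hh : IsSmoothMetric h) (hO : IsOpen O)
    (hsub : O ⊆ (extChartAt I p).target) (hX : ContDiffOn ℝ ∞ (coordField X p) O)
    (hY : ContDiffOn ℝ ∞ (coordField Y p) O) (hZ : ContDiffOn ℝ ∞ (coordField Z p) O) :
    Set.EqOn (coordField (curvature h X Y Z) p)
      (fun u => curvatureOf (christoffel h p) u (coordField X p u) (coordField Y p u)
        (coordField Z p u)) O := by
  intro u hu
  have hc := isConnectionOn_christoffel hh hO hsub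
  simp only [curvature, coordField_sub, Pi.sub_apply, mlieBracket_eq_nabla hh X Y]
  rw [eqOn_coordField_nabla hh hO hsub X (contDiffOn_coordField_nabla hh hO hsub hY hZ) hu,
    eqOn_coordField_nabla hh hO hsub Y (contDiffOn_coordField_nabla hh hO hsub hX hZ) hu,
    eqOn_coordField_nabla hh hO hsub _ hZ hu,
    nablaOf_congr hO (eqOn_coordField_nabla hh hO hsub Y hZ) _ hu,
    nablaOf_congr hO (eqOn_coordField_nabla hh hO hsub X hZ) _ hu, coordField_sub,
    ← hc.nablaOf_curvature hu hX hY hZ]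
  congr 1
  refine nablaOf_congr_at _ _ ?_
  simp only [Pi.sub_apply, eqOn_coordField_nabla hh hO hsub X hY hu,
    eqOn_coordField_nabla hh hO hsub Y hX hu]

theorem contDiffOn_coordField_curvature (hh : IsSmoothMetric h) (hO : IsOpen O)
    (hsub : O ⊆ (extChartAt I p).target) (hX : ContDiffOn ℝ ∞ (coordField X p) O)
    (hY : ContDiffOn ℝ ∞ (coordField Y p) O) (hZ : ContDiffOn ℝ ∞ (coordField Z p) O) :
    ContDiffOn ℝ ∞ (coordField (curvature h X Y Z) p) O :=
  ((((isConnectionOn_christoffel hh hO hsub).contDiffOn_curvatureOf.clm_apply hX).clm_apply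
    hY).clm_apply hZ).congr (eqOn_coordField_curvature hh hO hsub hX hY hZ)

/-- In any chart, the covariant derivative of the curvature is given by the tensor of that chart. -/
theorem eqOn_coordField_nablaCurvature (hh : IsSmoothMetric h) (hO : IsOpen O)
    (hsub : O ⊆ (extChartAt I p).target) (hW : ContDiffOn ℝ ∞ (coordField W p) O)
    (hX : ContDiffOn ℝ ∞ (coordField X p) O)
    (hY : ContDiffOn ℝ ∞ (coordField Y p) O) (hZ : ContDiffOn ℝ ∞ (coordField Z p) O) :
    Set.EqOn (coordField (nablaCurvature h W X Y Z) p)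
      (fun u => nablaCurvatureOf (christoffel h p) u (coordField W p u) (coordField X p u)
        (coordField Y p u) (coordField Z p u)) O := by
  intro u hu
  have hc := isConnectionOn_christoffel hh hO hsub
  have n {V : ∀ q : N, TangentSpace I q} (hV : ContDiffOn ℝ ∞ (coordField V p) O) :=
    contDiffOn_coordField_nabla hh hO hsub hW hV
  have d {V : F → F} (hV : ContDiffOn ℝ ∞ V O) := differentiableAt_of_contDiffOn hO hV hu
  simp only [nablaCurvature, coordField_sub, Pi.sub_apply]
  rw [eqOn_coordField_nabla hh hO hsub W (contDiffOn_coordField_curvature hh hO hsub hX hY hZ) hu,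
    nablaOf_congr hO (eqOn_coordField_curvature hh hO hsub hX hY hZ) _ hu,
    eqOn_coordField_curvature hh hO hsub (n hX) hY hZ hu,
    eqOn_coordField_curvature hh hO hsub hX (n hY) hZ hu,
    eqOn_coordField_curvature hh hO hsub hX hY (n hZ) hu, nablaOf,
    fderiv_apply_three (hc.differentiableAt_curvatureOf hu) (d hX) (d hY) (d hZ)]
  simp only [eqOn_coordField_nabla hh hO hsub W hX hu, eqOn_coordField_nabla hh hO hsub W hY hu,
    eqOn_coordField_nabla hh hO hsub W hZ hu, nablaOf, map_add, add_apply, nablaCurvatureOf]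
  abel

end CoordCurvature

section Smoothness

variable {F : Type*} [NormedAddCommGroup F] [NormedSpace ℝ F]
  {H : Type*} [TopologicalSpace H] {I : ModelWithCorners ℝ F H}
  {N : Type*} [TopologicalSpace N] [ChartedSpace H N] [IsManifold I ∞ N]

theorem contDiffOn_coordField {X : ∀ q : N, TangentSpace I q} {U : Set N}
    (hX : ContMDiffOn I I.tangent ∞ (fun x => (⟨x, X x⟩ : TangentBundle I N)) U) (p : N) :
    ContDiffOn ℝ ∞ (coordField X p) ((extChartAt I p).target ∩ (extChartAt I p).symm ⁻¹' U) := by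
  set e := trivializationAt F (TangentSpace I : N → Type _) p with he
  have hbase (u : F) (hu : u ∈ (extChartAt I p).target) : (extChartAt I p).symm u ∈ e.baseSet := by
    rw [he, TangentBundle.trivializationAt_baseSet, ← extChartAt_source I]
    exact (extChartAt I p).map_target hu
  have h1 : ContMDiffOn I I.tangent ∞ (fun x => (⟨x, X x⟩ : TangentBundle I N)) (U ∩ e.baseSet) :=
    hX.mono Set.inter_subset_left
  have h2 : ContMDiffOn I 𝓘(ℝ, F) ∞ (fun x => (e (⟨x, X x⟩ : TangentBundle I N)).2)
      (U ∩ e.baseSet) :=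
    ((e.contMDiffOn_iff (fun x hx => e.mem_source.2 hx.2)).1 h1).2
  have h3 : ContMDiffOn 𝓘(ℝ, F) 𝓘(ℝ, F) ∞ ((fun x => (e (⟨x, X x⟩ : TangentBundle I N)).2) ∘
      (extChartAt I p).symm) ((extChartAt I p).target ∩ (extChartAt I p).symm ⁻¹' U) :=
    h2.comp ((contMDiffOn_extChartAt_symm p).mono Set.inter_subset_left)
      fun u hu => ⟨hu.2, hbase u hu.1⟩
  refine (contMDiffOn_iff_contDiffOn.1 h3).congr fun u hu => ?_
  rw [coordField, Trivialization.continuousLinearMapAt_apply,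
    Trivialization.coe_linearMapAt_of_mem _ (hbase u hu.1)]
  rfl

variable [FiniteDimensional ℝ F] [I.Boundaryless]

theorem isSmoothMetric_inner
    (g : ContMDiffRiemannianMetric I ∞ F (fun x : N => TangentSpace I x)) :
    IsSmoothMetric g.inner := by
  intro p
  set e := trivializationAt F (TangentSpace I : N → Type _) p with he
  have hbase (u : F) (hu : u ∈ (extChartAt I p).target) : (extChartAt I p).symm u ∈ e.baseSet := by
    rw [he, TangentBundle.trivializationAt_baseSet, ← extChartAt_source I]
    exact (extChartAt I p).map_target hu
  have hap (u v w : F) : coordMetric g.inner p u v w = g.inner ((extChartAt I p).symm u)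
      (e.symmL ℝ ((extChartAt I p).symm u) v) (e.symmL ℝ ((extChartAt I p).symm u) w) := rfl
  refine ⟨isOpen_extChartAt_target p, ?_, fun u hu v w => ?_, fun u hu => ?_⟩
  · rw [contDiffOn_clm_apply]
    intro v
    rw [contDiffOn_clm_apply]
    intro w
    have hs (v : F) : ContMDiffOn I (I.prod 𝓘(ℝ, F)) ∞
        (fun x => TotalSpace.mk' F x (e.symmL ℝ x v)) e.baseSet := by
      have h1 : ContMDiffOn I (I.prod 𝓘(ℝ, F)) ∞ (fun x : N => (x, v)) e.baseSet :=
        contMDiffOn_id.prodMk contMDiffOn_const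
      have h2 := (e.contMDiffOn_symm (n := ∞) (IB := I)).comp h1
        fun x hx => e.mem_target.2 hx
      refine h2.congr fun x hx => ?_
      rw [Function.comp_apply, e.symmL_apply hx]
      exact e.mk_symm hx v
    have h3 := ContMDiffOn.clm_bundle_apply₂ (E₃ := fun _ : N => ℝ) (F₃ := ℝ)
      (g.contMDiff.contMDiffOn (s := e.baseSet)) (hs v) (hs w)
    have h4 : ContMDiffOn I 𝓘(ℝ, ℝ) ∞
        (fun x => g.inner x (e.symmL ℝ x v) (e.symmL ℝ x w)) e.baseSet := fun x hx => by
      have := h3 x hx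
      simp only [contMDiffWithinAt_totalSpace] at this
      exact this.2
    have h5 := h4.comp (contMDiffOn_extChartAt_symm p) hbase
    exact contMDiffOn_iff_contDiffOn.1 h5
  · rw [hap, hap, g.symm]
  · refine isInvertible_of_nondegenerate fun v hv => ?_
    by_contra hne
    have hz : e.symmL ℝ ((extChartAt I p).symm u) v ≠ 0 := fun h0 => hne <| by
      have h1 := e.continuousLinearMapAt_symmL (R := ℝ) (hbase u hu) v
      rw [h0, map_zero] at h1
      exact h1.symm
    exact (g.pos _ _ hz).ne' (hv v)

end Smoothness

section TangentCharts

variable {E : Type*} [NormedAddCommGroup E] [NormedSpace ℝ E]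
  {H : Type*} [TopologicalSpace H] {I : ModelWithCorners ℝ E H}
  {M : Type*} [TopologicalSpace M] [ChartedSpace H M] [IsManifold I ∞ M]

theorem extChartAt_tangent_apply (p r : TangentBundle I M) :
    extChartAt I.tangent p r
      = (extChartAt I p.proj r.proj, tangentCoordChange I r.proj p.proj r.proj r.2) := rfl

theorem extChartAt_tangent_target (p : TangentBundle I M) :
    (extChartAt I.tangent p).target = (extChartAt I p.proj).target ×ˢ Set.univ := by
  have h := FiberBundle.extChartAt_target (IB := I) (F := E) (E := (TangentSpace I : M → Type _)) p
  refine h.trans ?_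
  congr 1
  refine Set.inter_eq_left.2 fun u hu => ?_
  rw [Set.mem_preimage, TangentBundle.trivializationAt_baseSet, ← extChartAt_source I]
  exact (extChartAt I p.proj).map_target hu

/-- The fibre coordinates of a point of the tangent bundle. -/
theorem tangentCoordChange_snd {p : TangentBundle I M} {u : E × E}
    (hu : u.1 ∈ (extChartAt I p.proj).target) :
    tangentCoordChange I ((extChartAt I p.proj).symm u.1) p.proj ((extChartAt I p.proj).symm u.1)
      ((extChartAt I.tangent p).symm u).2 = u.2 := by
  have h1 : u ∈ (extChartAt I.tangent p).target := by
    rw [extChartAt_tangent_target]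
    exact ⟨hu, trivial⟩
  exact congrArg Prod.snd ((extChartAt I.tangent p).right_inv h1)

variable [I.Boundaryless]

theorem extChartAt_tangent_chartChange {p q : TangentBundle I M} {u : E × E}
    (hu : u.1 ∈ overlap I p.proj q.proj) :
    extChartAt I.tangent q ((extChartAt I.tangent p).symm u)
      = ((extChartAt I q.proj ∘ (extChartAt I p.proj).symm) u.1,
        fderiv ℝ (extChartAt I q.proj ∘ (extChartAt I p.proj).symm) u.1 u.2) := by
  obtain ⟨h1, h2⟩ := mem_overlap.1 hu
  have h3 := tangentCoordChange_snd (p := p) h1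
  set r := (extChartAt I.tangent p).symm u with hr
  have hpr : r.proj = (extChartAt I p.proj).symm u.1 := rfl
  rw [← hpr] at h3 h2
  have h4 : r.proj ∈ (extChartAt I p.proj).source := (extChartAt I p.proj).map_target h1
  have h5 : extChartAt I p.proj r.proj = u.1 := (extChartAt I p.proj).right_inv h1
  rw [extChartAt_tangent_apply]
  refine Prod.ext rfl ?_
  rw [← h5, ← tangentCoordChange_eq_fderiv]
  simp only
  rw [← h3]
  exact (tangentCoordChange_comp ⟨⟨mem_extChartAt_source _, h4⟩, h2⟩).symm

theorem fderiv_tangent_chartChange {p q : TangentBundle I M} {u : E × E}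
    (hu : u.1 ∈ overlap I p.proj q.proj) (ξ : E × E) :
    fderiv ℝ (extChartAt I.tangent q ∘ (extChartAt I.tangent p).symm) u ξ
      = (fderiv ℝ (extChartAt I q.proj ∘ (extChartAt I p.proj).symm) u.1 ξ.1,
        fderiv ℝ (fderiv ℝ (extChartAt I q.proj ∘ (extChartAt I p.proj).symm)) u.1 ξ.1 u.2
        + fderiv ℝ (extChartAt I q.proj ∘ (extChartAt I p.proj).symm) u.1 ξ.2) := by
  set φ := extChartAt I q.proj ∘ (extChartAt I p.proj).symm with hφ
  have hopen := isOpen_overlap (I := I) p.proj q.proj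
  have hs := contDiffOn_chartChange (I := I) p.proj q.proj
  have d1 : DifferentiableAt ℝ φ u.1 := differentiableAt_of_contDiffOn hopen hs hu
  have d2 : DifferentiableAt ℝ (fderiv ℝ φ) u.1 :=
    differentiableAt_of_contDiffOn hopen (contDiffOn_fderiv hopen hs) hu
  have d1' : DifferentiableAt ℝ (fun v : E × E => φ v.1) u :=
    DifferentiableAt.comp (g := φ) u d1 differentiableAt_fst
  have d2' : DifferentiableAt ℝ (fun v : E × E => fderiv ℝ φ v.1) u :=
    DifferentiableAt.comp (g := fderiv ℝ φ) u d2 differentiableAt_fst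
  have hev : Set.EqOn (extChartAt I.tangent q ∘ (extChartAt I.tangent p).symm)
      (fun v : E × E => (φ v.1, fderiv ℝ φ v.1 v.2)) (overlap I p.proj q.proj ×ˢ Set.univ) :=
    fun v hv => extChartAt_tangent_chartChange hv.1
  rw [fderiv_eq_of_eqOn (hopen.prod isOpen_univ) hev ⟨hu, trivial⟩,
    DifferentiableAt.fderiv_prodMk d1' (d2'.clm_apply differentiableAt_snd),
    ContinuousLinearMap.prod_apply, fderiv_comp_fst d1, fderiv_apply_one d2' differentiableAt_snd,
    fderiv_comp_fst d2, fderiv_snd_apply]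

section Lifts

variable {g : ∀ x : M, TangentSpace I x →L[ℝ] TangentSpace I x →L[ℝ] ℝ} {p : TangentBundle I M}
  {u : E × E}

/-- The derivative of a change of induced coordinates maps horizontal and vertical components to
horizontal and vertical components. -/
theorem christoffel_tangent_chartChange (hg : IsSmoothMetric g)
    (hu : u.1 ∈ (extChartAt I p.proj).target) (v : E) :
    let r := (extChartAt I.tangent p).symm u
    let φ := extChartAt I r.proj ∘ (extChartAt I p.proj).symm
    fderiv ℝ (fderiv ℝ φ) u.1 v u.2
        + christoffel g r.proj (extChartAt I r.proj r.proj) r.2 (fderiv ℝ φ u.1 v)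
      = fderiv ℝ φ u.1 (christoffel g p.proj u.1 u.2 v) := by
  intro r φ
  have hpr : r.proj = (extChartAt I p.proj).symm u.1 := rfl
  have hrr := mem_extChartAt_source (I := I) r.proj
  have hrp : r.proj ∈ (extChartAt I p.proj).source := (extChartAt I p.proj).map_target hu
  have ho : u.1 ∈ overlap I p.proj r.proj := mem_overlap.2 ⟨hu, hrr⟩
  have hsnd : (r.2 : E) = fderiv ℝ φ u.1 u.2 := by
    have h3 : tangentCoordChange I r.proj p.proj r.proj r.2 = u.2 :=
      tangentCoordChange_snd (p := p) hu
    have h5 : extChartAt I p.proj r.proj = u.1 := (extChartAt I p.proj).right_inv hu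
    have h6 : fderiv ℝ φ u.1 = tangentCoordChange I p.proj r.proj r.proj := by
      rw [tangentCoordChange_eq_fderiv, h5]
    rw [h6, ← h3]
    exact ((tangentCoordChange_comp ⟨⟨hrr, hrp⟩, hrr⟩).trans (tangentCoordChange_self hrr)).symm
  have hΓ := christoffel_chartChange hg ho u.2 v
  rw [hΓ, ← hpr, ← fderiv_fderiv_symm (isOpen_overlap p.proj r.proj)
    (contDiffOn_chartChange p.proj r.proj) ho v u.2]
  exact congrArg (fun y : E => fderiv ℝ (fderiv ℝ φ) u.1 v u.2
    + christoffel g r.proj (extChartAt I r.proj r.proj) y (fderiv ℝ φ u.1 v)) hsnd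

/-- The `g`-natural metric in induced coordinates. -/
theorem coordMetric_gNatural (hg : IsSmoothMetric g) (a b c : ℝ)
    (hu : u ∈ (extChartAt I.tangent p).target) :
    coordMetric (gNatural g a b c) p u = gNaturalOf (coordMetric g p.proj) a b c u := by
  have hu1 : u.1 ∈ (extChartAt I p.proj).target := by
    rw [extChartAt_tangent_target] at hu
    exact hu.1
  have hΓ := christoffel_tangent_chartChange (p := p) hg hu1
  set r := (extChartAt I.tangent p).symm u with hr
  set φ := extChartAt I r.proj ∘ (extChartAt I p.proj).symm with hφ
  have hrs : r ∈ (extChartAt I.tangent p).source := (extChartAt I.tangent p).map_target hu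
  have hpr : extChartAt I.tangent p r = u := (extChartAt I.tangent p).right_inv hu
  have ho : u.1 ∈ overlap I p.proj r.proj :=
    mem_overlap.2 ⟨hu1, mem_extChartAt_source (I := I) r.proj⟩
  have hγ (v w : E) : coordMetric g p.proj u.1 v w
      = (g r.proj : E →L[ℝ] E →L[ℝ] ℝ) (fderiv ℝ φ u.1 v) (fderiv ℝ φ u.1 w) := by
    have h4 : r.proj ∈ (extChartAt I p.proj).source := (extChartAt I p.proj).map_target hu1
    have h5 : extChartAt I p.proj r.proj = u.1 := (extChartAt I p.proj).right_inv hu1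
    have := coordMetric_extChartAt g h4 v w
    rw [tangentCoordChange_eq_fderiv, h5] at this
    exact this
  refine ContinuousLinearMap.ext fun ξ => ContinuousLinearMap.ext fun η => ?_
  have e1 := coordMetric_extChartAt (gNatural g a b c) hrs ξ η
  rw [hpr, tangentCoordChange_eq_fderiv, hpr, fderiv_tangent_chartChange ho,
    fderiv_tangent_chartChange ho] at e1
  have hG (A B : E × E) : (gNatural g a b c r : E × E →L[ℝ] E × E →L[ℝ] ℝ) A B
      = (a + c) * (g r.proj : E →L[ℝ] E →L[ℝ] ℝ) A.1 B.1
        + b * ((g r.proj : E →L[ℝ] E →L[ℝ] ℝ) A.1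
            (B.2 + christoffel g r.proj (extChartAt I r.proj r.proj) r.2 B.1)
          + (g r.proj : E →L[ℝ] E →L[ℝ] ℝ)
            (A.2 + christoffel g r.proj (extChartAt I r.proj r.proj) r.2 A.1) B.1)
        + a * (g r.proj : E →L[ℝ] E →L[ℝ] ℝ)
            (A.2 + christoffel g r.proj (extChartAt I r.proj r.proj) r.2 A.1)
            (B.2 + christoffel g r.proj (extChartAt I r.proj r.proj) r.2 B.1) := by
    have e (x y z w : ℝ) :
        a * (x + y) + b * (z + w) + c * x = (a + c) * x + b * (z + w) + a * y := by
      ring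
    exact e _ _ _ _
  have hk (ξ : E × E) : fderiv ℝ (fderiv ℝ φ) u.1 ξ.1 u.2 + fderiv ℝ φ u.1 ξ.2
      + christoffel g r.proj (extChartAt I r.proj r.proj) r.2 (fderiv ℝ φ u.1 ξ.1)
      = fderiv ℝ φ u.1 (verOf (christoffelOf (coordMetric g p.proj)) u ξ) := by
    rw [verOf_apply, map_add, add_right_comm, hΓ ξ.1, add_comm]
    rfl
  rw [e1, hG, gNaturalOf_apply]
  simp only [← hφ, hk, hγ]

/-- Horizontal lifts in induced coordinates. -/
theorem coordField_hliftField (hg : IsSmoothMetric g) (X : ∀ x : M, TangentSpace I x)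
    (hu : u ∈ (extChartAt I.tangent p).target) :
    coordField (hliftField g X) p u
      = liftOf (christoffel g p.proj) u (coordField X p.proj u.1) 0 := by
  have hu1 : u.1 ∈ (extChartAt I p.proj).target := by
    rw [extChartAt_tangent_target] at hu
    exact hu.1
  have hΓ := christoffel_tangent_chartChange (p := p) hg hu1
  set r := (extChartAt I.tangent p).symm u with hr
  set φ := extChartAt I r.proj ∘ (extChartAt I p.proj).symm with hφ
  have hrs : r ∈ (extChartAt I.tangent p).source := (extChartAt I.tangent p).map_target hu
  have hrr := mem_extChartAt_source (I := I.tangent) r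
  have hpr : extChartAt I.tangent p r = u := (extChartAt I.tangent p).right_inv hu
  have ho : u.1 ∈ overlap I p.proj r.proj :=
    mem_overlap.2 ⟨hu1, mem_extChartAt_source (I := I) r.proj⟩
  have hX : (X r.proj : E) = fderiv ℝ φ u.1 (coordField X p.proj u.1) := by
    have e := coordField_chartChange X ho
    rw [show (extChartAt I p.proj).symm u.1 = r.proj from rfl, coordField_self] at e
    exact e
  set A := coordField X p.proj u.1 with hA
  have hlift : (hliftField g X r : E × E)
      = tangentCoordChange I.tangent p r r (liftOf (christoffel g p.proj) u A 0) := by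
    rw [tangentCoordChange_eq_fderiv, hpr, fderiv_tangent_chartChange ho]
    refine Prod.ext hX ?_
    have e1 := hΓ A
    have e2 : (hliftField g X r : E × E).2
        = - christoffel g r.proj (extChartAt I r.proj r.proj) r.2 (fderiv ℝ φ u.1 A) :=
      congrArg (fun v : E => - christoffel g r.proj (extChartAt I r.proj r.proj) r.2 v) hX
    rw [e2]
    simp only [liftOf, zero_sub, map_neg]
    rw [← e1]
    abel
  have e0 := coordField_extChartAt (hliftField g X) hrs
  rw [hpr] at e0
  rw [e0]
  refine (congrArg (tangentCoordChange I.tangent r p r) hlift).trans ?_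
  rw [tangentCoordChange_comp ⟨⟨hrs, hrr⟩, hrs⟩, tangentCoordChange_self hrs]

end Lifts

end TangentCharts

section Congruence

variable {F : Type*} [NormedAddCommGroup F] [NormedSpace ℝ F] {O : Set F}

theorem IsMetricOn.congr {γ γ' : F → F →L[ℝ] F →L[ℝ] ℝ} (h : IsMetricOn γ O)
    (e : Set.EqOn γ' γ O) : IsMetricOn γ' O :=
  ⟨h.isOpen, h.contDiffOn.congr e, fun u hu => by rw [e hu]; exact h.symm u hu,
    fun u hu => by rw [e hu]; exact h.isInvertible u hu⟩

theorem eqOn_christoffelOf {γ γ' : F → F →L[ℝ] F →L[ℝ] ℝ} (hO : IsOpen O)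
    (e : Set.EqOn γ' γ O) : Set.EqOn (christoffelOf γ') (christoffelOf γ) O := fun u hu => by
  simp only [christoffelOf, fderiv_eq_of_eqOn hO e hu, e hu]

theorem eqOn_curvatureOf {Γ Γ' : F → F →L[ℝ] F →L[ℝ] F} (hO : IsOpen O)
    (e : Set.EqOn Γ' Γ O) : Set.EqOn (curvatureOf Γ') (curvatureOf Γ) O := fun u hu => by
  simp only [curvatureOf, fderiv_eq_of_eqOn hO e hu, e hu]

end Congruence

section Assembly

variable {E : Type*} [NormedAddCommGroup E] [NormedSpace ℝ E]
  {H : Type*} [TopologicalSpace H] {I : ModelWithCorners ℝ E H}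
  {M : Type*} [TopologicalSpace M] [ChartedSpace H M] [IsManifold I ∞ M]
  {g : ∀ x : M, TangentSpace I x →L[ℝ] TangentSpace I x →L[ℝ] ℝ} {a b c : ℝ}

theorem liftOf_eq_hlift_add_vlift (p : TangentBundle I M) (v w : E) :
    liftOf (christoffelOf (coordMetric g p.proj)) (extChartAt I p.proj p.proj, p.2) v w
      = hlift g p v + vlift p w := by
  have e : liftOf (christoffelOf (coordMetric g p.proj)) (extChartAt I p.proj p.proj, p.2) v w
      = (v + 0, - christoffel g p.proj (extChartAt I p.proj p.proj) p.2 v + w) := by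
    refine Prod.ext (add_zero v).symm ?_
    rw [neg_add_eq_sub]
    rfl
  exact e

variable [FiniteDimensional ℝ E] [I.Boundaryless]

theorem isSmoothMetric_gNatural (hg : IsSmoothMetric g) (ha : a ≠ 0)
    (hα : a * (a + c) - b ^ 2 ≠ 0) : IsSmoothMetric (gNatural g a b c) := fun p => by
  have h := isMetricOn_gNaturalOf (hg p.proj) ha hα
  rw [← extChartAt_tangent_target] at h
  exact h.congr fun u hu => coordMetric_gNatural hg a b c hu

/-- The curvature of the `g`-natural metric on horizontal lifts, in induced coordinates. -/
theorem curvature_gNatural_hliftField (hg : IsSmoothMetric g) (ha : a ≠ 0)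
    (hα : a * (a + c) - b ^ 2 ≠ 0) {X Y Z : ∀ x : M, TangentSpace I x}
    {p : TangentBundle I M} {O : Set E} (hO : IsOpen O)
    (hsub : O ⊆ (extChartAt I p.proj).target) (hp : extChartAt I p.proj p.proj ∈ O)
    (hX : ContDiffOn ℝ ∞ (coordField X p.proj) O) (hY : ContDiffOn ℝ ∞ (coordField Y p.proj) O)
    (hZ : ContDiffOn ℝ ∞ (coordField Z p.proj) O) :
    let γ := coordMetric g p.proj
    let u : E × E := (extChartAt I p.proj p.proj, p.2)
    (curvature (gNatural g a b c) (hliftField g X) (hliftField g Y) (hliftField g Z) p : E × E)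
      = curvatureOf (christoffelOf (gNaturalOf γ a b c)) u (liftOf (christoffelOf γ) u (X p.proj) 0)
          (liftOf (christoffelOf γ) u (Y p.proj) 0) (liftOf (christoffelOf γ) u (Z p.proj) 0) := by
  intro γ u
  have hG := isSmoothMetric_gNatural hg ha hα
  have hu : extChartAt I.tangent p p = u := by
    rw [extChartAt_tangent_apply]
    exact Prod.ext rfl (tangentCoordChange_self (mem_extChartAt_source p.proj))
  have hO' : IsOpen (O ×ˢ (Set.univ : Set E)) := hO.prod isOpen_univ
  have hsub' : O ×ˢ Set.univ ⊆ (extChartAt I.tangent p).target := by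
    rw [extChartAt_tangent_target]
    exact Set.prod_mono hsub subset_rfl
  have hs {V : ∀ x : M, TangentSpace I x} (hV : ContDiffOn ℝ ∞ (coordField V p.proj) O) :
      ContDiffOn ℝ ∞ (coordField (hliftField g V) p) (O ×ˢ Set.univ) := by
    refine (contDiffOn_liftOf ((hg p.proj).mono hO hsub)
      (A := fun q => coordField V p.proj q.1) (B := fun _ => 0)
      (hV.comp contDiffOn_fst fun q hq => hq.1) contDiffOn_const).congr fun q hq => ?_
    exact coordField_hliftField hg V (hsub' hq)
  have hmem : u ∈ O ×ˢ (Set.univ : Set E) := ⟨hp, trivial⟩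
  have hval (V : ∀ x : M, TangentSpace I x) :
      coordField (hliftField g V) p u = liftOf (christoffelOf γ) u (V p.proj) 0 := by
    rw [coordField_hliftField hg V (hsub' hmem), coordField_self]
    rfl
  have e1 := eqOn_coordField_curvature hG hO' hsub' (hs hX) (hs hY) (hs hZ) hmem
  have e2 : Set.EqOn (christoffel (gNatural g a b c) p) (christoffelOf (gNaturalOf γ a b c))
      (O ×ˢ Set.univ) :=
    eqOn_christoffelOf hO' fun q hq => coordMetric_gNatural hg a b c (hsub' hq)
  simp only [hval, eqOn_curvatureOf hO' e2 hmem] at e1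
  rw [← e1, ← hu, coordField_self]

end Assembly

end GNat

end

theorem stmt_4 {E : Type*} [NormedAddCommGroup E] [NormedSpace ℝ E] [FiniteDimensional ℝ E]
    (hn : 3 ≤ Module.finrank ℝ E)
    {M : Type*} [TopologicalSpace M] [ChartedSpace E M] [IsManifold 𝓘(ℝ, E) ∞ M]
    (g : ContMDiffRiemannianMetric 𝓘(ℝ, E) ∞ E (fun x : M => TangentSpace 𝓘(ℝ, E) x))
    (a b c α : ℝ) (ha : 0 < a) (hα : α = a * (a + c) - b ^ 2) (hα_pos : 0 < α)
    (U : Set M) (hU : IsOpen U)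
    (X Y Z t : ∀ x : M, TangentSpace 𝓘(ℝ, E) x)
    (hX : ContMDiffOn 𝓘(ℝ, E) 𝓘(ℝ, E).tangent ∞
      (fun x => (⟨x, X x⟩ : TangentBundle 𝓘(ℝ, E) M)) U)
    (hY : ContMDiffOn 𝓘(ℝ, E) 𝓘(ℝ, E).tangent ∞
      (fun x => (⟨x, Y x⟩ : TangentBundle 𝓘(ℝ, E) M)) U)
    (hZ : ContMDiffOn 𝓘(ℝ, E) 𝓘(ℝ, E).tangent ∞
      (fun x => (⟨x, Z x⟩ : TangentBundle 𝓘(ℝ, E) M)) U)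
    (ht : ContMDiffOn 𝓘(ℝ, E) 𝓘(ℝ, E).tangent ∞
      (fun x => (⟨x, t x⟩ : TangentBundle 𝓘(ℝ, E) M)) U)
    (x : M) (hx : x ∈ U) (y : TangentSpace 𝓘(ℝ, E) x) (hty : t x = y) :
    let R := GNat.curvature g.inner
    let DR := GNat.nablaCurvature g.inner
    GNat.curvature (GNat.gNatural g.inner a b c) (GNat.hliftField g.inner X)
        (GNat.hliftField g.inner Y) (GNat.hliftField g.inner Z) ⟨x, y⟩
      = GNat.hlift g.inner ⟨x, y⟩
          ((R X Y Z
            + (a * b / (2 * α)) • ((2 : ℝ) • DR t X Y Z - DR Z X Y t)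
            + (a ^ 2 / (4 * α)) • (R (R Y Z t) t X - R (R X Z t) t Y)
            + (a ^ 2 * b ^ 2 / (4 * α ^ 2)) •
                (R X t (R Y t Z) + R X t (R Z t Y) - R Y t (R X t Z) - R Y t (R Z t X))
            - (a ^ 2 / (2 * α)) • R (R X Y t) t Z) x)
        + GNat.vlift ⟨x, y⟩
          ((- ((b ^ 2 / α) • DR t X Y Z)
            + (a * (a + c) / (2 * α)) • DR Z X Y t
            + (a * b ^ 3 / (2 * α ^ 2)) •
                (R (R Y t Z) X t - R X t (R Z t Y) - R (R X t Z) Y t + R Y t (R Z t X))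
            + (a ^ 2 * b * (a + c) / (4 * α ^ 2)) •
                (R X (R Y t Z) t + R X (R Z t Y) t - R Y (R X t Z) t - R Y (R Z t X) t
                  - R (R Y Z t) t X + R (R X Z t) t Y)
            + (a * b / (2 * α)) • R (R X Y t) t Z) x) := by
  subst hty
  intro R DR
  have hg := GNat.isSmoothMetric_inner g
  have hα₀ : α ≠ 0 := hα_pos.ne'
  set O := (extChartAt 𝓘(ℝ, E) x).target ∩ (extChartAt 𝓘(ℝ, E) x).symm ⁻¹' U with hOdef
  have hO : IsOpen O := (continuousOn_extChartAt_symm x).isOpen_inter_preimage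
    (isOpen_extChartAt_target x) hU
  have hsub : O ⊆ (extChartAt 𝓘(ℝ, E) x).target := Set.inter_subset_left
  have hxO : extChartAt 𝓘(ℝ, E) x x ∈ O :=
    ⟨mem_extChartAt_target x, by rwa [Set.mem_preimage, extChartAt_to_inv]⟩
  let S := {V : ∀ x : M, TangentSpace 𝓘(ℝ, E) x // ContDiffOn ℝ ∞ (GNat.coordField V x) O}
  let X' : S := ⟨X, GNat.contDiffOn_coordField hX x⟩
  let Y' : S := ⟨Y, GNat.contDiffOn_coordField hY x⟩
  let Z' : S := ⟨Z, GNat.contDiffOn_coordField hZ x⟩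
  let t' : S := ⟨t, GNat.contDiffOn_coordField ht x⟩
  let val : S → E := fun V => V.1 x
  let r : S → S → S → S := fun A B C => ⟨R A.1 B.1 C.1,
    GNat.contDiffOn_coordField_curvature hg hO hsub A.2 B.2 C.2⟩
  let Γ := GNat.christoffelOf (GNat.coordMetric g.inner x)
  let u := extChartAt 𝓘(ℝ, E) x x
  have hr (A B C : S) : GNat.curvatureOf Γ u (val A) (val B) (val C) = val (r A B C) := by
    have e := GNat.eqOn_coordField_curvature hg hO hsub A.2 B.2 C.2 hxO
    simp only [GNat.coordField_self] at e
    exact e.symm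
  have hd (W A B C : S) : GNat.nablaCurvatureOf Γ u (val W) (val A) (val B) (val C)
      = (DR W.1 A.1 B.1 C.1 x : E) := by
    have e := GNat.eqOn_coordField_nablaCurvature hg hO hsub W.2 A.2 B.2 C.2 hxO
    simp only [GNat.coordField_self] at e
    exact e.symm
  have e1 := GNat.curvature_gNatural_hliftField (p := ⟨x, t x⟩) hg ha.ne' (hα ▸ hα₀) hO hsub hxO
    X'.2 Y'.2 Z'.2
  have e2 := GNat.curvatureOf_gNaturalOf (hg x) ha.ne' hα hα₀ (t := val t')
    (mem_extChartAt_target x) (val X') (val Y') (val Z')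
  have e3 := e1.trans e2
  dsimp only at e3
  simp only [show GNat.christoffelOf (GNat.coordMetric g.inner x) = Γ from rfl,
    show extChartAt 𝓘(ℝ, E) x x = u from rfl, hr, hd] at e3
  exact e3.trans (GNat.liftOf_eq_hlift_add_vlift (g := g.inner) ⟨x, t x⟩ _ _)
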